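/- arXiv:1908.08882 — 6 statements merged into one kernel-verified Lean document; each statement's English description precedes it below -/
import Mathlib

section
/- A sunflower graph 𝒢 = (G_1,…,G_k) has a simultaneous unit interval representation that realizes a simultaneous enumeration ζ = (ζ_1,…,ζ_k) if and only if there exists a graph H with vertex set V(𝒢) = V_1 ∪ … ∪ V_k that contains each G_i as an induced subgraph and has a fine enumeration σ such that for each i ∈ {1,…,k} the straight enumeration ζ_i is compatible with σ on V_i (i.e. u ≤_σ v implies B(u,G_i) ≤_{ζ_i} B(v,G_i) never fails: for u,v ∈ V_i, B(u,G_i) <_{ζ_i} B(v,G_i) implies u <_σ v). -/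
/-!
Common definitions: graphs on a vertex subset, (proper/unit) interval
representations, blocks, straight enumerations, sunflower graphs,
simultaneous enumerations, components, chains/bars, etc.
-/

universe u

/-- A finite simple graph on a subset `verts` of an ambient vertex type `V`. -/
structure GraphOn (V : Type u) where
  verts : Set V
  Adj : V → V → Prop
  symm : ∀ {u v}, Adj u v → Adj v u
  loopless : ∀ v, ¬ Adj v v
  mem_of_adj : ∀ {u v}, Adj u v → u ∈ verts ∧ v ∈ verts

namespace GraphOn

variable {V : Type u}

/-- The closed real interval assigned to vertex `v` by the endpoint map `I`. -/
def ivl (I : V → ℝ × ℝ) (v : V) : Set ℝ := Set.Icc (I v).1 (I v).2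

/-- `I` is an interval representation of `G`: each vertex gets a (nonempty) closed
interval and intervals of distinct vertices intersect iff the vertices are adjacent. -/
def IsRep (G : GraphOn V) (I : V → ℝ × ℝ) : Prop :=
  (∀ v ∈ G.verts, (I v).1 ≤ (I v).2) ∧
    ∀ u ∈ G.verts, ∀ v ∈ G.verts, u ≠ v → ((ivl I u ∩ ivl I v).Nonempty ↔ G.Adj u v)

/-- A proper interval representation: no interval properly contains another. -/
def IsProperRep (G : GraphOn V) (I : V → ℝ × ℝ) : Prop :=
  G.IsRep I ∧ ∀ u ∈ G.verts, ∀ v ∈ G.verts, u ≠ v → ¬ ivl I v ⊂ ivl I u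

/-- A unit interval representation: all intervals have length one. -/
def IsUnitRep (G : GraphOn V) (I : V → ℝ × ℝ) : Prop :=
  G.IsRep I ∧ ∀ v ∈ G.verts, (I v).2 = (I v).1 + 1

/-- Two vertices are in the same block iff they have equal closed neighborhoods. -/
def SameBlock (G : GraphOn V) (u v : V) : Prop :=
  u ∈ G.verts ∧ v ∈ G.verts ∧ ∀ w, (G.Adj u w ∨ u = w) ↔ (G.Adj v w ∨ v = w)

/-- Block-level closed adjacency: adjacent or in the same block. -/
def CAdj (G : GraphOn V) (u v : V) : Prop := G.Adj u v ∨ G.SameBlock u v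

/-- `u` and `v` lie in the same connected component of `G` (and in `G`). -/
def Reach (G : GraphOn V) (u v : V) : Prop :=
  u ∈ G.verts ∧ v ∈ G.verts ∧ Relation.ReflTransGen G.Adj u v

/-- The subgraph of `G` induced on the vertices of `G` lying in `C`. -/
def restrict (G : GraphOn V) (C : Set V) : GraphOn V where
  verts := G.verts ∩ C
  Adj u v := G.Adj u v ∧ u ∈ C ∧ v ∈ C
  symm h := ⟨G.symm h.1, h.2.2, h.2.1⟩
  loopless v h := G.loopless v h.1
  mem_of_adj h := ⟨⟨(G.mem_of_adj h.1).1, h.2.1⟩, (G.mem_of_adj h.1).2, h.2.2⟩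

end GraphOn

open GraphOn

variable {V : Type u}

/-- The union graph `G_1 ∪ … ∪ G_k`. -/
def unionGraph {k : ℕ} (G : Fin k → GraphOn V) : GraphOn V where
  verts := ⋃ i, (G i).verts
  Adj u v := ∃ i, (G i).Adj u v
  symm h := h.elim fun i hi => ⟨i, (G i).symm hi⟩
  loopless v h := h.elim fun i hi => (G i).loopless v hi
  mem_of_adj h := h.elim fun i hi =>
    ⟨Set.mem_iUnion.2 ⟨i, ((G i).mem_of_adj hi).1⟩,
     Set.mem_iUnion.2 ⟨i, ((G i).mem_of_adj hi).2⟩⟩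

/-- A straight enumeration of `G`, encoded at the vertex level: `le u v` means the
block of `u` comes at or before the block of `v`.  It is a total preorder on the
vertices whose equivalence classes are exactly the blocks, and such that every block
together with its adjacent blocks is consecutive. -/
structure StraightEnum {V : Type u} (G : GraphOn V) where
  le : V → V → Prop
  refl : ∀ v ∈ G.verts, le v v
  trans : ∀ u ∈ G.verts, ∀ v ∈ G.verts, ∀ w ∈ G.verts, le u v → le v w → le u w
  total : ∀ u ∈ G.verts, ∀ v ∈ G.verts, le u v ∨ le v u
  eq_block : ∀ u ∈ G.verts, ∀ v ∈ G.verts, (le u v ∧ le v u ↔ G.SameBlock u v)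
  straight : ∀ u ∈ G.verts, ∀ v ∈ G.verts, ∀ w ∈ G.verts,
    le u v → le v w → G.CAdj u w → G.CAdj u v ∧ G.CAdj v w

/-- `B(u,G) <_σ B(v,G)`: the block of `u` comes strictly before the block of `v`. -/
def StraightEnum.lt {V : Type u} {G : GraphOn V} (σ : StraightEnum G) (u v : V) : Prop :=
  σ.le u v ∧ ¬ σ.le v u

/-- `le` is a linear order on the set `s`. -/
def IsLinOrdOn (s : Set V) (le : V → V → Prop) : Prop :=
  (∀ v ∈ s, le v v) ∧ (∀ u ∈ s, ∀ v ∈ s, ∀ w ∈ s, le u v → le v w → le u w) ∧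
    (∀ u ∈ s, ∀ v ∈ s, le u v → le v u → u = v) ∧ (∀ u ∈ s, ∀ v ∈ s, le u v ∨ le v u)

/-- `le` is a partial order on the set `s`. -/
def IsPartialOrderOn (s : Set V) (le : V → V → Prop) : Prop :=
  (∀ v ∈ s, le v v) ∧ (∀ u ∈ s, ∀ v ∈ s, ∀ w ∈ s, le u v → le v w → le u w) ∧
    (∀ u ∈ s, ∀ v ∈ s, le u v → le v u → u = v)

/-- `S` is an induced subgraph of `G`. -/
def IsInduced (S G : GraphOn V) : Prop :=
  S.verts ⊆ G.verts ∧ ∀ u ∈ S.verts, ∀ v ∈ S.verts, (S.Adj u v ↔ G.Adj u v)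

/-- `(G_1,…,G_k)` is a sunflower graph with shared graph `S`: any two distinct
graphs share exactly `S` (vertices and edges), and `S` is induced in each `G_i`. -/
def IsSunflower {k : ℕ} (G : Fin k → GraphOn V) (S : GraphOn V) : Prop :=
  (∀ i, IsInduced S (G i)) ∧
    ∀ i j, i ≠ j → (G i).verts ∩ (G j).verts = S.verts ∧
      ∀ u v, (G i).Adj u v → (G j).Adj u v → S.Adj u v

/-- `𝒢` admits a simultaneous interval representation. -/
def HasSimRep {k : ℕ} (G : Fin k → GraphOn V) : Prop :=
  ∃ I : V → ℝ × ℝ, ∀ i, (G i).IsRep I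

/-- `𝒢` admits a simultaneous proper interval representation. -/
def HasSimProperRep {k : ℕ} (G : Fin k → GraphOn V) : Prop :=
  ∃ I : V → ℝ × ℝ, ∀ i, (G i).IsProperRep I

/-- `𝒢` admits a simultaneous unit interval representation. -/
def HasSimUnitRep {k : ℕ} (G : Fin k → GraphOn V) : Prop :=
  ∃ I : V → ℝ × ℝ, ∀ i, (G i).IsUnitRep I

/-- The representation `I` of `G` corresponds to (realizes) the straight enumeration `σ`:
ordering the intervals by left endpoints and grouping blocks yields `σ`. -/
def Realizes (G : GraphOn V) (I : V → ℝ × ℝ) (σ : StraightEnum G) : Prop :=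
  ∀ u ∈ G.verts, ∀ v ∈ G.verts, σ.lt u v → (I u).1 < (I v).1

/-- Simultaneous enumeration: blocks containing shared vertices are never ordered
oppositely in two of the straight enumerations. -/
def IsSimEnum {k : ℕ} (G : Fin k → GraphOn V) (S : GraphOn V)
    (σ : ∀ i, StraightEnum (G i)) : Prop :=
  ∀ i j, ∀ u ∈ S.verts, ∀ v ∈ S.verts, (σ i).lt u v → (σ j).le u v

/-- A straight enumeration `σ` of `G` is compatible with a linear order `ζ` of the
shared vertex set `VS`: `u ≤_ζ v` implies `B(u,G) ≤_σ B(v,G)`. -/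
def Compatible (G : GraphOn V) (σ : StraightEnum G) (VS : Set V) (ζ : V → V → Prop) : Prop :=
  ∀ u ∈ VS, ∀ v ∈ VS, ζ u v → σ.le u v

/-- The component of `c` in `G` is loose: all its shared vertices lie in one block of `S`. -/
def LooseAt (G S : GraphOn V) (c : V) : Prop :=
  c ∈ G.verts ∧ ∀ u v, G.Reach c u → G.Reach c v → u ∈ S.verts → v ∈ S.verts → S.SameBlock u v

/-- The component of `c` in `G` is oriented at the block of `b` in `S`: it aligns two
vertices of that block (they lie in different blocks of the component). -/
def OrientedAt (G S : GraphOn V) (c b : V) : Prop :=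
  c ∈ G.verts ∧ b ∈ S.verts ∧ ∃ u v, G.Reach c u ∧ G.Reach c v ∧
    S.SameBlock b u ∧ S.SameBlock b v ∧ ¬ G.SameBlock u v

/-- The component of `c` in `G` is independent: it aligns no two shared vertices. -/
def IndependentAt (G S : GraphOn V) (c : V) : Prop :=
  c ∈ G.verts ∧ ∀ u v, G.Reach c u → G.Reach c v → u ∈ S.verts → v ∈ S.verts → G.SameBlock u v

/-- `le'` is obtained from `le` by reversing exactly the components marked by `flip`
(componentwise-constant), keeping the order of the components themselves. -/
def ObtainedByFlip (G : GraphOn V) (flip : V → Prop) (le le' : V → V → Prop) : Prop :=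
  (∀ u v, G.Reach u v → (flip u ↔ flip v)) ∧
    ∀ u ∈ G.verts, ∀ v ∈ G.verts,
      (G.Reach u v → ((flip u → (le' u v ↔ le v u)) ∧ (¬ flip u → (le' u v ↔ le u v)))) ∧
      (¬ G.Reach u v → (le' u v ↔ le u v))

/-- `le'` is obtained from `le` through reversal of loose components. -/
def ObtainedByLooseReversals (G S : GraphOn V) (le le' : V → V → Prop) : Prop :=
  ∃ flip : V → Prop, (∀ c ∈ G.verts, flip c → LooseAt G S c) ∧
    ObtainedByFlip G flip le le'

/-- A family of flips (one per graph) corresponding to reversals of independent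
components and of reversible parts: only loose components are flipped, and all
components oriented at a common block of `S` are flipped consistently and, if
flipped, are all loose. -/
def ValidFlips {k : ℕ} (G : Fin k → GraphOn V) (S : GraphOn V)
    (flip : Fin k → V → Prop) : Prop :=
  (∀ i, ∀ c ∈ (G i).verts, flip i c → LooseAt (G i) S c) ∧
    ∀ b ∈ S.verts, ∀ i j c c', OrientedAt (G i) S c b → OrientedAt (G j) S c' b →
      (flip i c ↔ flip j c') ∧ (flip i c → LooseAt (G j) S c')

/-- `le` is a fine enumeration of the graph with vertex set `verts` and adjacency
`Adj`: a linear order on `verts` in which every closed neighborhood is consecutive. -/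
def FineEnumOn (verts : Set V) (Adj : V → V → Prop) (le : V → V → Prop) : Prop :=
  IsLinOrdOn verts le ∧
    ∀ u ∈ verts, ∀ a ∈ verts, ∀ b ∈ verts, ∀ c ∈ verts,
      le a b → le b c → (Adj u a ∨ u = a) → (Adj u c ∨ u = c) → (Adj u b ∨ u = b)

/-- A `(u,v)`-chain of size `l` in `(G,σ)`: a `σ`-increasing sequence from `u` to `v`
forming a path in `G`. -/
def IsChainSeq (G : GraphOn V) (σ : StraightEnum G) (u v : V) (l : ℕ) : Prop :=
  ∃ c : ℕ → V, c 0 = u ∧ c (l - 1) = v ∧ (∀ t < l, c t ∈ G.verts) ∧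
    (∀ s t, s < t → t < l → σ.lt (c s) (c t)) ∧
    (∀ t, t + 1 < l → G.Adj (c t) (c (t + 1)))

/-- A `(u,v)`-bar of size `l` in `(G,σ)`: a `σ`-increasing sequence from `u` to `v`
forming an independent set in `G`. -/
def IsBarSeq (G : GraphOn V) (σ : StraightEnum G) (u v : V) (l : ℕ) : Prop :=
  ∃ b : ℕ → V, b 0 = u ∧ b (l - 1) = v ∧ (∀ t < l, b t ∈ G.verts) ∧
    (∀ s t, s < t → t < l → σ.lt (b s) (b t)) ∧
    (∀ s t, s < l → t < l → s ≠ t → ¬ G.Adj (b s) (b t))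

/-- `𝒢` has a (chain-bar-)conflict for the simultaneous enumeration `σ`. -/
def HasConflict {k : ℕ} (G : Fin k → GraphOn V) (S : GraphOn V)
    (σ : ∀ i, StraightEnum (G i)) : Prop :=
  ∃ u ∈ S.verts, ∃ v ∈ S.verts, u ≠ v ∧ ∃ i j l, 2 ≤ l ∧
    IsChainSeq (G i) (σ i) u v l ∧ ∃ m, l ≤ m ∧ IsBarSeq (G j) (σ j) u v m

/-- The union of the block orders of the single enumerations. -/
def alphaStar {k : ℕ} (G : Fin k → GraphOn V) (σ : ∀ i, StraightEnum (G i))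
    (u v : V) : Prop :=
  ∃ i, u ∈ (G i).verts ∧ v ∈ (G i).verts ∧ (σ i).le u v

/-- The partial order `α` on `V(𝒢)` induced by the simultaneous enumeration:
the transitive closure of the union of the single block orders. -/
def alphaOrd {k : ℕ} (G : Fin k → GraphOn V) (σ : ∀ i, StraightEnum (G i)) :
    V → V → Prop :=
  Relation.TransGen (alphaStar G σ)

/-- The `α`-ordered pairs that are edges of some `G_i`. -/
def ERel {k : ℕ} (G : Fin k → GraphOn V) (σ : ∀ i, StraightEnum (G i))
    (u v : V) : Prop :=
  alphaOrd G σ u v ∧ ∃ i, (G i).Adj u v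

/-- The `α`-ordered pairs that are non-edges of some `G_i` (both endpoints in `G_i`). -/
def FRel {k : ℕ} (G : Fin k → GraphOn V) (σ : ∀ i, StraightEnum (G i))
    (u v : V) : Prop :=
  alphaOrd G σ u v ∧ u ≠ v ∧ ∃ i, u ∈ (G i).verts ∧ v ∈ (G i).verts ∧ ¬ (G i).Adj u v

/-- A partial order `τ` is left-closed: `(v,w) ∈ E`, `(u,x) ∈ F` and `x ≤_τ w`
imply `u <_τ v`. -/
def LeftClosed {k : ℕ} (G : Fin k → GraphOn V) (σ : ∀ i, StraightEnum (G i))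
    (τ : V → V → Prop) : Prop :=
  ∀ v w u x, ERel G σ v w → FRel G σ u x → τ x w → τ u v ∧ u ≠ v

/-- A relaxed `(u,v)`-chain of size `l`: an `α`-increasing sequence from `u` to `v`
forming a path in the union graph `G* = G_1 ∪ … ∪ G_k`. -/
def IsRelaxedChainSeq {k : ℕ} (G : Fin k → GraphOn V) (σ : ∀ i, StraightEnum (G i))
    (u v : V) (l : ℕ) : Prop :=
  ∃ c : ℕ → V, c 0 = u ∧ c (l - 1) = v ∧ (∀ t < l, c t ∈ ⋃ i, (G i).verts) ∧
    (∀ s t, s < t → t < l → alphaOrd G σ (c s) (c t) ∧ c s ≠ c t) ∧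
    (∀ t, t + 1 < l → ∃ i, (G i).Adj (c t) (c (t + 1)))

/-- `𝒢` has a relaxed conflict for the simultaneous enumeration `σ`. -/
def HasRelaxedConflict {k : ℕ} (G : Fin k → GraphOn V) (S : GraphOn V)
    (σ : ∀ i, StraightEnum (G i)) : Prop :=
  ∃ u ∈ S.verts, ∃ v ∈ S.verts, u ≠ v ∧ ∃ j l, 2 ≤ l ∧
    IsRelaxedChainSeq G σ u v l ∧ ∃ m, l ≤ m ∧ IsBarSeq (G j) (σ j) u v m

/-- A finite set in a linear order with an adjacency relation satisfying the umbrella property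
maps strictly monotonically into `ℝ` so that adjacency of `a < b` amounts to distance less than
one and no two points are at distance exactly one. -/
theorem exists_real_embedding_of_umbrella {α : Type*} [LinearOrder α] (A : α → α → Prop)
    (hA : ∀ a b c, a < b → b < c → A a c → A a b ∧ A b c) (s : Finset α) :
    ∃ x : α → ℝ, ∀ a ∈ s, ∀ b ∈ s, a < b →
      x a < x b ∧ (A a b → x b < x a + 1) ∧ (¬ A a b → x a + 1 < x b) := by
  classical
  induction s using Finset.induction_on_max with
  | empty => exact ⟨fun _ => 0, by simp⟩
  | insert m s hm ih =>
    obtain ⟨x, hx⟩ := ih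
    have hle : ∀ a ∈ s, ∀ b ∈ s, A b m → x a < x b + 1 := by
      intro a ha b hb hbm
      rcases lt_trichotomy a b with h | rfl | h
      · linarith [(hx a ha b hb h).1]
      · linarith
      · exact (hx b hb a ha h).2.1 (hA b a m h (hm a ha) hbm).1
    have hlt : ∀ a ∈ s, ∀ b ∈ s, ¬ A a m → A b m → x a + 1 < x b + 1 := by
      intro a ha b hb ham hbm
      rcases lt_trichotomy a b with h | rfl | h
      · linarith [(hx a ha b hb h).1]
      · exact absurd hbm ham
      · exact absurd (hA b a m h (hm a ha) hbm).2 ham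
    obtain ⟨y, hlo, hhi⟩ := Order.exists_between_finsets
      (s.image x ∪ (s.filter (fun a => ¬ A a m)).image (fun a => x a + 1))
      ((s.filter (fun a => A a m)).image (fun a => x a + 1)) (by
        simp only [Finset.mem_union, Finset.mem_image, Finset.mem_filter]
        rintro _ (⟨a, ha, rfl⟩ | ⟨a, ⟨ha, ham⟩, rfl⟩) _ ⟨b, ⟨hb, hbm⟩, rfl⟩
        · exact hle a ha b hb hbm
        · exact hlt a ha b hb ham hbm)
    simp only [Finset.mem_union, Finset.mem_image, Finset.mem_filter] at hlo hhi
    refine ⟨Function.update x m y, fun a ha b hb hab => ?_⟩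
    have hms : ∀ a ∈ s, Function.update x m y a = x a := fun a ha =>
      Function.update_of_ne (hm a ha).ne _ _
    rcases Finset.mem_insert.1 ha with rfl | has
    · rcases Finset.mem_insert.1 hb with rfl | hb
      · exact absurd hab (lt_irrefl _)
      · exact absurd hab (hm b hb).asymm
    · rcases Finset.mem_insert.1 hb with rfl | hb
      · rw [hms a has, Function.update_self]
        exact ⟨hlo _ (Or.inl ⟨a, has, rfl⟩), fun h => hhi _ ⟨a, ⟨has, h⟩, rfl⟩,
          fun h => hlo _ (Or.inr ⟨a, ⟨has, h⟩, rfl⟩)⟩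
      · rw [hms a has, hms b hb]
        exact hx a has b hb hab

theorem unit_ivl_inter_nonempty_iff {I : V → ℝ × ℝ} {u v : V}
    (hu : (I u).2 = (I u).1 + 1) (hv : (I v).2 = (I v).1 + 1) :
    (ivl I u ∩ ivl I v).Nonempty ↔ (I u).1 ≤ (I v).1 + 1 ∧ (I v).1 ≤ (I u).1 + 1 := by
  rw [ivl, ivl, Set.Icc_inter_Icc, Set.nonempty_Icc, hu, hv, sup_le_iff, le_inf_iff, le_inf_iff]
  constructor
  · rintro ⟨⟨-, h⟩, h', -⟩
    exact ⟨h, h'⟩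
  · rintro ⟨h, h'⟩
    exact ⟨⟨by linarith, h⟩, h', by linarith⟩

/-- A graph with a fine enumeration has a unit interval representation whose left endpoints
are strictly increasing along the enumeration. -/
theorem FineEnumOn.exists_isUnitRep [Finite V] {H : GraphOn V} {τ : V → V → Prop}
    (hτ : FineEnumOn H.verts H.Adj τ) :
    ∃ I : V → ℝ × ℝ, H.IsUnitRep I ∧
      ∀ u ∈ H.verts, ∀ v ∈ H.verts, τ u v → u ≠ v → (I u).1 < (I v).1 := by
  classical
  obtain ⟨⟨hrefl, htrans, hanti, htot⟩, hfine⟩ := hτ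
  let _ : LinearOrder H.verts :=
    { le := fun a b => τ a b
      le_refl := fun a => hrefl a a.2
      le_trans := fun a b c => htrans a a.2 b b.2 c c.2
      le_antisymm := fun a b h h' => Subtype.ext (hanti a a.2 b b.2 h h')
      le_total := fun a b => htot a a.2 b b.2
      toDecidableLE := Classical.decRel _ }
  have := Fintype.ofFinite H.verts
  have hA : ∀ a b c : H.verts, a < b → b < c → H.Adj a c → H.Adj a b ∧ H.Adj b c := by
    intro a b c hab hbc hac
    have hab' : τ a b := hab.le
    have hbc' : τ b c := hbc.le
    have h₁ := hfine a a.2 a a.2 b b.2 c c.2 hab' hbc' (Or.inr rfl) (Or.inl hac)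
    have h₂ := hfine c c.2 a a.2 b b.2 c c.2 hab' hbc' (Or.inl (H.symm hac)) (Or.inr rfl)
    exact ⟨h₁.resolve_right fun h => hab.ne (Subtype.ext h),
      H.symm (h₂.resolve_right fun h => hbc.ne' (Subtype.ext h))⟩
  obtain ⟨x, hx⟩ := exists_real_embedding_of_umbrella (fun a b : H.verts => H.Adj a b) hA
    Finset.univ
  replace hx := fun a b => hx a (Finset.mem_univ a) b (Finset.mem_univ b)
  let f : V → ℝ := fun v => if h : v ∈ H.verts then x ⟨v, h⟩ else 0
  have hf : ∀ a : H.verts, f a = x a := fun a => dif_pos a.2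
  have hadj : ∀ a b : H.verts, a < b →
      ((f a ≤ f b + 1 ∧ f b ≤ f a + 1) ↔ H.Adj a b) := by
    intro a b hab
    obtain ⟨h₁, h₂, h₃⟩ := hx a b hab
    rw [hf, hf]
    refine ⟨fun h => ?_, fun h => ⟨by linarith, (h₂ h).le⟩⟩
    by_contra hn
    exact absurd (h₃ hn) h.2.not_gt
  refine ⟨fun v => (f v, f v + 1), ⟨⟨fun v _ => by simp, ?_⟩, fun v _ => rfl⟩, ?_⟩
  · intro u hu v hv huv
    rw [unit_ivl_inter_nonempty_iff rfl rfl]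
    rcases lt_or_gt_of_ne (fun h => huv (congrArg Subtype.val h) :
      (⟨u, hu⟩ : H.verts) ≠ ⟨v, hv⟩) with h | h
    · exact hadj _ _ h
    · rw [and_comm, hadj _ _ h]
      exact ⟨H.symm, H.symm⟩
  · intro u hu v hv huv hne
    have h : (⟨u, hu⟩ : H.verts) < ⟨v, hv⟩ :=
      lt_of_le_of_ne huv fun h => hne (congrArg Subtype.val h)
    simpa only [← hf] using (hx _ _ h).1

/-- The intersection graph of the unit intervals with left endpoints `f` on the vertices `s`. -/
def unitIntersectionGraph (s : Set V) (f : V → ℝ) : GraphOn V where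
  verts := s
  Adj u v := u ∈ s ∧ v ∈ s ∧ u ≠ v ∧ f u ≤ f v + 1 ∧ f v ≤ f u + 1
  symm h := ⟨h.2.1, h.1, h.2.2.1.symm, h.2.2.2.2, h.2.2.2.1⟩
  loopless _ h := h.2.2.1 rfl
  mem_of_adj h := ⟨h.1, h.2.1⟩

/-- Ordering the vertices by left endpoint, with ties broken by an injection into a linear
order, is a fine enumeration of a unit intersection graph. -/
theorem fineEnumOn_unitIntersectionGraph {β : Type*} [LinearOrder β] (s : Set V) (f : V → ℝ)
    {e : V → β} (he : Function.Injective e) :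
    FineEnumOn (unitIntersectionGraph s f).verts (unitIntersectionGraph s f).Adj
      (fun u v => toLex (f u, e u) ≤ toLex (f v, e v)) := by
  have hle : ∀ u v, toLex (f u, e u) ≤ toLex (f v, e v) → f u ≤ f v := fun u v h => by
    rcases (Prod.Lex.toLex_le_toLex).1 h with h | h
    exacts [h.le, h.1.le]
  refine ⟨⟨fun _ _ => le_rfl, fun _ _ _ _ _ _ => le_trans, fun u _ v _ h h' => ?_,
    fun _ _ _ _ => le_total _ _⟩, ?_⟩
  · exact he (congrArg Prod.snd (toLex.injective (le_antisymm h h')))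
  · intro u hu a _ b hb c _ hab hbc ha hc
    have h₁ := hle _ _ hab
    have h₂ := hle _ _ hbc
    refine or_iff_not_imp_right.2 fun hne => ⟨hu, hb, hne, ?_, ?_⟩
    · rcases ha with ha | rfl
      · linarith [ha.2.2.2.1]
      · linarith
    · rcases hc with hc | rfl
      · linarith [hc.2.2.2.2]
      · linarith

/-- A sunflower graph has a simultaneous unit interval representation
realizing a simultaneous enumeration `ζ` iff there is a graph `H` on `V(𝒢)` containing
each `G_i` as an induced subgraph and having a fine enumeration with which each `ζ_i`
is compatible. -/
theorem simUnitRealization_iff_sandwich {V : Type u} [Fintype V] {k : ℕ}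
    (G : Fin k → GraphOn V) (S : GraphOn V) (hsun : IsSunflower G S)
    (ζ : ∀ i, StraightEnum (G i)) (hζ : IsSimEnum G S ζ) :
    (∃ I : V → ℝ × ℝ, (∀ i, (G i).IsUnitRep I) ∧ ∀ i, Realizes (G i) I (ζ i)) ↔
      ∃ H : GraphOn V, H.verts = (⋃ i, (G i).verts) ∧ (∀ i, IsInduced (G i) H) ∧
        ∃ τ : V → V → Prop, FineEnumOn H.verts H.Adj τ ∧
          ∀ i, ∀ u ∈ (G i).verts, ∀ v ∈ (G i).verts,
            (ζ i).lt u v → (τ u v ∧ u ≠ v) := by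
  constructor
  · rintro ⟨I, hI, hreal⟩
    refine ⟨unitIntersectionGraph (⋃ i, (G i).verts) (fun v => (I v).1), rfl, ?_, _,
      fineEnumOn_unitIntersectionGraph _ _ (Fintype.equivFin V).injective, ?_⟩
    · refine fun i => ⟨Set.subset_iUnion (fun i => (G i).verts) i, fun u hu v hv => ?_⟩
      have hiff (huv : u ≠ v) := ((hI i).1.2 u hu v hv huv).symm.trans
        (unit_ivl_inter_nonempty_iff ((hI i).2 u hu) ((hI i).2 v hv))
      constructor
      · intro h
        have huv : u ≠ v := by
          rintro rfl
          exact (G i).loopless _ h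
        exact ⟨Set.mem_iUnion.2 ⟨i, hu⟩, Set.mem_iUnion.2 ⟨i, hv⟩, huv, (hiff huv).1 h⟩
      · rintro ⟨-, -, huv, h⟩
        exact (hiff huv).2 h
    · intro i u hu v hv h
      have hlt := hreal i u hu v hv h
      refine ⟨Prod.Lex.toLex_le_toLex.2 (Or.inl hlt), ?_⟩
      rintro rfl
      exact lt_irrefl _ hlt
  · rintro ⟨H, -, hind, τ, hτ, hcomp⟩
    obtain ⟨I, ⟨⟨hle, hadj⟩, hunit⟩, hmono⟩ := hτ.exists_isUnitRep
    refine ⟨I, fun i => ⟨⟨fun v hv => hle v ((hind i).1 hv), fun u hu v hv huv => ?_⟩,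
      fun v hv => hunit v ((hind i).1 hv)⟩, fun i u hu v hv h => ?_⟩
    · rw [hadj u ((hind i).1 hu) v ((hind i).1 hv) huv, (hind i).2 u hu v hv]
    · obtain ⟨h₁, h₂⟩ := hcomp i u hu v hv h
      exact hmono u ((hind i).1 hu) v ((hind i).1 hv) h₁ h₂
end

section
/- A linear order σ on the vertex set of a finite simple graph H = (V,E) is a fine enumeration of H if and only if there do not exist four vertices v, u, x, w ∈ V with v ≤_σ u ≤_σ x ≤_σ w such that vw ∈ E and ux ∉ E (where u ≠ x). -/
/-- `H` together with the linear order of its vertex type has a fine enumeration: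
every closed neighborhood is consecutive with respect to the order. -/
def SimpleGraph.FineEnumeration {V : Type*} [LinearOrder V] (H : SimpleGraph V) : Prop :=
  ∀ u a b c : V, a ≤ b → b ≤ c →
    (H.Adj u a ∨ u = a) → (H.Adj u c ∨ u = c) → (H.Adj u b ∨ u = b)

/-- A linear order of the vertices of a finite simple graph is a fine
enumeration iff there are no four vertices `v ≤ u ≤ x ≤ w` with `vw ∈ E`, `u ≠ x`
and `ux ∉ E`. -/
theorem fineEnumeration_iff_no_forbidden_config {V : Type*} [Fintype V] [LinearOrder V]
    (H : SimpleGraph V) :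
    H.FineEnumeration ↔
      ¬ ∃ v u x w : V, v ≤ u ∧ u ≤ x ∧ x ≤ w ∧ H.Adj v w ∧ u ≠ x ∧ ¬ H.Adj u x := by
  constructor
  · rintro h ⟨v, u, x, w, hvu, hux, hxw, hvw, hne, hnadj⟩
    have hvx : v ≠ x := (hvu.trans_lt (lt_of_le_of_ne hux hne)).ne
    have hadj : H.Adj v x :=
      (h v v x w (hvu.trans hux) hxw (Or.inr rfl) (Or.inl hvw)).resolve_right hvx
    have hxu : H.Adj x u :=
      (h x v u x hvu hux (Or.inl hadj.symm) (Or.inr rfl)).resolve_right hne.symm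
    exact hnadj hxu.symm
  · intro h u a b c hab hbc ha hc
    by_contra! hb
    obtain ⟨hnadj, hne⟩ := hb
    rcases lt_or_gt_of_ne hne with hlt | hgt
    · have huc : H.Adj u c := hc.resolve_right (hlt.trans_le hbc).ne
      exact h ⟨u, u, b, c, le_rfl, hlt.le, hbc, huc, hne, hnadj⟩
    · have hua : H.Adj u a := ha.resolve_right (hab.trans_lt hgt).ne'
      exact h ⟨a, b, u, u, hab, hgt.le, le_rfl, hua.symm, hne.symm, fun hbu => hnadj hbu.symm⟩
end

section
/- Let 𝒢 be a sunflower proper interval graph with simultaneous enumeration ζ. Then 𝒢 has a simultaneous unit interval representation that realizes ζ if and only if 𝒢 has no conflict for ζ. -/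
/-!
Common definitions: graphs on a vertex subset, (proper/unit) interval
representations, blocks, straight enumerations, sunflower graphs,
simultaneous enumerations, components, chains/bars, etc.
-/

universe u

open GraphOn

variable {V : Type u}

/-! ### Semiorders with a compatible ranking -/

section Semiorder

/-- `stepRel r n` is the `(n + 1)`-fold composition of `r` with itself. -/
def stepRel (r : V → V → Prop) : ℕ → V → V → Prop
  | 0 => r
  | n + 1 => fun u w => ∃ v, stepRel r n u v ∧ r v w

theorem stepRel_mono {r r' : V → V → Prop} (h : ∀ u v, r u v → r' u v) :
    ∀ {n : ℕ} {u v : V}, stepRel r n u v → stepRel r' n u v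
  | 0, _, _, huv => h _ _ huv
  | _ + 1, _, _, ⟨w, huw, hwv⟩ => ⟨w, stepRel_mono h huw, h _ _ hwv⟩

theorem stepRel_absorb_right {r : V → V → Prop} {v w : V} (h : ∀ u, r u v → r u w) :
    ∀ {n : ℕ} {u : V}, stepRel r n u v → stepRel r n u w
  | 0, _, huv => h _ huv
  | _ + 1, _, ⟨z, huz, hzv⟩ => ⟨z, huz, h _ hzv⟩

theorem stepRel_absorb_left {r : V → V → Prop} {u v : V} (h : ∀ w, r v w → r u w) :
    ∀ {n : ℕ} {w : V}, stepRel r n v w → stepRel r n u w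
  | 0, _, hvw => h _ hvw
  | _ + 1, _, ⟨z, hvz, hzw⟩ => ⟨z, stepRel_absorb_left h hvz, hzw⟩

theorem stepRel_exists_seq {r : V → V → Prop} :
    ∀ {n : ℕ} {u v : V}, stepRel r n u v →
      ∃ b : ℕ → V, b 0 = u ∧ b (n + 1) = v ∧ ∀ t ≤ n, r (b t) (b (t + 1))
  | 0, u, v, h => by
    refine ⟨fun t => if t = 0 then u else v, by simp, by simp, fun t ht => ?_⟩
    obtain rfl : t = 0 := by omega
    exact h
  | n + 1, u, v, ⟨w, huw, hwv⟩ => by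
    obtain ⟨b, h0, hn, hb⟩ := stepRel_exists_seq huw
    refine ⟨fun t => if t ≤ n + 1 then b t else v, by simpa using h0, by simp, fun t ht => ?_⟩
    rcases Nat.lt_or_ge n t with h | h
    · obtain rfl : t = n + 1 := by omega
      simpa [hn] using hwv
    · simpa [show t ≤ n + 1 by omega, h] using hb t h

/-- `far` is a semiorder on `A` compatible with the weak order given by the rank `ρ`. -/
structure IsRankedSemiorder (A : Set V) (ρ : V → ℕ) (far : V → V → Prop) : Prop where
  mem_left : ∀ {u v}, far u v → u ∈ A
  mem_right : ∀ {u v}, far u v → v ∈ A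
  rank_lt : ∀ {u v}, far u v → ρ u < ρ v
  far_le : ∀ {u v w}, far u v → w ∈ A → ρ v ≤ ρ w → far u w
  le_far : ∀ {u v w}, u ∈ A → ρ u ≤ ρ v → far v w → far u w

/-- `v` is not far to the left of `u`. -/
def NearRel (A : Set V) (far : V → V → Prop) (u v : V) : Prop :=
  u ∈ A ∧ v ∈ A ∧ ¬ far v u

/-- The combinatorial lower bound `a` on the distance from `u` to `v`: the case `a = 0` says that
`u` comes before `v`, positive bounds are compositions of `far`, and negative bounds are
compositions of `NearRel`. -/
def Gap (A : Set V) (ρ : V → ℕ) (far : V → V → Prop) : ℤ → V → V → Prop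
  | Int.ofNat 0 => fun u v => u ∈ A ∧ v ∈ A ∧ ρ u < ρ v
  | Int.ofNat (n + 1) => stepRel far n
  | Int.negSucc n => stepRel (NearRel A far) n

theorem NearRel.gap {A : Set V} {ρ : V → ℕ} {far : V → V → Prop} {u v : V}
    (h : NearRel A far u v) : Gap A ρ far (-1) u v := by
  rw [show (-1 : ℤ) = Int.negSucc 0 from rfl]
  exact h

namespace IsRankedSemiorder

variable {A : Set V} {ρ : V → ℕ} {far : V → V → Prop}

theorem near_of_le (R : IsRankedSemiorder A ρ far) {u v : V} (hu : u ∈ A) (hv : v ∈ A)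
    (h : ρ u ≤ ρ v) : NearRel A far u v :=
  ⟨hu, hv, fun hf => absurd (R.rank_lt hf) (by omega)⟩

theorem near_le (R : IsRankedSemiorder A ρ far) {u v w : V} (h : NearRel A far u v) (hw : w ∈ A)
    (hvw : ρ v ≤ ρ w) :
    NearRel A far u w :=
  ⟨h.1, hw, fun hf => h.2.2 (R.le_far h.2.1 hvw hf)⟩

theorem le_near (R : IsRankedSemiorder A ρ far) {u v w : V} (hu : u ∈ A) (huv : ρ u ≤ ρ v)
    (h : NearRel A far v w) :
    NearRel A far u w :=
  ⟨hu, h.2.1, fun hf => h.2.2 (R.far_le hf h.1 huv)⟩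

theorem stepRel_far (R : IsRankedSemiorder A ρ far) {n : ℕ} {u v : V}
    (h : stepRel far n u v) : far u v := by
  induction n generalizing v with
  | zero => exact h
  | succ n ih =>
    obtain ⟨w, huw, hwv⟩ := h
    exact R.far_le (ih huw) (R.mem_right hwv) (R.rank_lt hwv).le

theorem stepRel_rank (R : IsRankedSemiorder A ρ far) {n : ℕ} {u v : V}
    (h : stepRel far n u v) : ρ u + n + 1 ≤ ρ v := by
  induction n generalizing v with
  | zero => exact R.rank_lt h
  | succ n ih =>
    obtain ⟨w, huw, hwv⟩ := h
    have := ih huw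
    have := R.rank_lt hwv
    omega

theorem stepRel_near_mem {n : ℕ} {u v : V} (h : stepRel (NearRel A far) n u v) :
    u ∈ A ∧ v ∈ A := by
  induction n generalizing v with
  | zero => exact ⟨h.1, h.2.1⟩
  | succ n ih =>
    obtain ⟨w, huw, hwv⟩ := h
    exact ⟨(ih huw).1, hwv.2.1⟩

theorem gap_mem (R : IsRankedSemiorder A ρ far) {a : ℤ} {u v : V}
    (h : Gap A ρ far a u v) : u ∈ A ∧ v ∈ A := by
  match a, h with
  | Int.ofNat 0, h => exact ⟨h.1, h.2.1⟩
  | Int.ofNat (n + 1), h => exact ⟨R.mem_left (R.stepRel_far h), R.mem_right (R.stepRel_far h)⟩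
  | Int.negSucc n, h => exact stepRel_near_mem h

theorem gap_rank (R : IsRankedSemiorder A ρ far) {a : ℤ} {u v : V} (ha : 0 ≤ a)
    (h : Gap A ρ far a u v) :
    ρ u + a ≤ ρ v ∧ ρ u < ρ v := by
  match a, h with
  | Int.ofNat 0, h => simpa using ⟨h.2.2.le, h.2.2⟩
  | Int.ofNat (n + 1), h =>
    have := R.stepRel_rank h
    simp only [Int.ofNat_eq_natCast]
    omega
  | Int.negSucc n, h => omega

theorem gap_self_neg (R : IsRankedSemiorder A ρ far) {a : ℤ} {u : V}
    (h : Gap A ρ far a u u) : a ≤ -1 := by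
  by_contra! ha
  exact lt_irrefl _ (R.gap_rank (by omega) h).2

theorem gap_le (R : IsRankedSemiorder A ρ far) {a : ℤ} {u v w : V} (h : Gap A ρ far a u v)
    (hw : w ∈ A) (hvw : ρ v ≤ ρ w) :
    Gap A ρ far a u w := by
  match a, h with
  | Int.ofNat 0, h => exact ⟨h.1, hw, h.2.2.trans_le hvw⟩
  | Int.ofNat (n + 1), h => exact stepRel_absorb_right (fun _ hf => R.far_le hf hw hvw) h
  | Int.negSucc n, h => exact stepRel_absorb_right (fun _ hf => R.near_le hf hw hvw) h

theorem le_gap (R : IsRankedSemiorder A ρ far) {a : ℤ} {u v w : V} (hu : u ∈ A) (huv : ρ u ≤ ρ v)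
    (h : Gap A ρ far a v w) :
    Gap A ρ far a u w := by
  match a, h with
  | Int.ofNat 0, h => exact ⟨hu, h.2.1, huv.trans_lt h.2.2⟩
  | Int.ofNat (n + 1), h => exact stepRel_absorb_left (fun _ hf => R.le_far hu huv hf) h
  | Int.negSucc n, h => exact stepRel_absorb_left (fun _ hf => R.le_near hu huv hf) h

theorem far_near (R : IsRankedSemiorder A ρ far) {u v w : V} (h : far u v)
    (h' : NearRel A far v w) : ρ u < ρ w := by
  by_contra! hle
  exact h'.2.2 (R.le_far h'.2.1 hle h)

theorem near_far (R : IsRankedSemiorder A ρ far) {u v w : V} (h : NearRel A far u v)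
    (h' : far v w) : ρ u < ρ w := by
  by_contra! hle
  exact h.2.2 (R.far_le h' h.1 hle)

theorem gap_far (R : IsRankedSemiorder A ρ far) {a : ℤ} {u v w : V} (h : Gap A ρ far a u v)
    (h' : far v w) :
    Gap A ρ far (a + 1) u w := by
  match a, h with
  | Int.ofNat 0, h => exact R.le_far h.1 h.2.2.le h'
  | Int.ofNat (n + 1), h => exact ⟨v, h, h'⟩
  | Int.negSucc 0, h => exact ⟨h.1, R.mem_right h', R.near_far h h'⟩
  | Int.negSucc (n + 1), ⟨z, hz, hzv⟩ =>
    exact stepRel_absorb_right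
      (fun _ hf => R.near_le hf (R.mem_right h') (R.near_far hzv h').le) hz

theorem gap_near (R : IsRankedSemiorder A ρ far) {a : ℤ} {u v w : V} (h : Gap A ρ far a u v)
    (h' : NearRel A far v w) :
    Gap A ρ far (a - 1) u w := by
  match a, h with
  | Int.ofNat 0, h => exact R.le_near h.1 h.2.2.le h'
  | Int.ofNat 1, h => exact ⟨R.mem_left h, h'.2.1, R.far_near h h'⟩
  | Int.ofNat (n + 2), ⟨z, hz, hzv⟩ =>
    have := stepRel_absorb_right
      (fun _ hf => R.far_le hf h'.2.1 (R.far_near hzv h').le) hz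
    have e : Int.ofNat (n + 2) - 1 = Int.ofNat (n + 1) := by
      simp only [Int.ofNat_eq_natCast]; omega
    rw [e]
    exact this
  | Int.negSucc n, h =>
    have e : Int.negSucc n - 1 = Int.negSucc (n + 1) := by omega
    rw [e]
    exact ⟨v, h, h'⟩

theorem gap_stepRel_far (R : IsRankedSemiorder A ρ far) {a : ℤ} {n : ℕ} {u v w : V}
    (h : Gap A ρ far a u v)
    (h' : stepRel far n v w) : Gap A ρ far (a + Int.ofNat (n + 1)) u w := by
  induction n generalizing w with
  | zero => exact R.gap_far h h'
  | succ n ih =>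
    obtain ⟨z, hz, hzw⟩ := h'
    have := R.gap_far (ih hz) hzw
    rwa [add_assoc] at this

theorem gap_stepRel_near (R : IsRankedSemiorder A ρ far) {a : ℤ} {n : ℕ} {u v w : V}
    (h : Gap A ρ far a u v)
    (h' : stepRel (NearRel A far) n v w) : Gap A ρ far (a + Int.negSucc n) u w := by
  induction n generalizing w with
  | zero => exact R.gap_near h h'
  | succ n ih =>
    obtain ⟨z, hz, hzw⟩ := h'
    have := R.gap_near (ih hz) hzw
    have e : a + Int.negSucc (n + 1) = a + Int.negSucc n - 1 := by omega
    rwa [e]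

theorem gap_trans (R : IsRankedSemiorder A ρ far) {a b : ℤ} {u v w : V} (h : Gap A ρ far a u v)
    (h' : Gap A ρ far b v w) :
    Gap A ρ far (a + b) u w := by
  match b, h' with
  | Int.ofNat 0, h' => simpa using R.gap_le h h'.2.1 h'.2.2.le
  | Int.ofNat (n + 1), h' => exact R.gap_stepRel_far h h'
  | Int.negSucc n, h' => exact R.gap_stepRel_near h h'

theorem far_split (R : IsRankedSemiorder A ρ far) {n : ℕ} {s t r : V} (h : stepRel far n s t)
    (hr : r ∈ A)
    (hsr : ρ s < ρ r) (hrt : ρ r < ρ t) :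
    ∃ a b : ℤ, Gap A ρ far a s r ∧ Gap A ρ far b r t ∧ (n : ℤ) ≤ a + b := by
  induction n generalizing t with
  | zero => exact ⟨0, 0, ⟨R.mem_left h, hr, hsr⟩, ⟨hr, R.mem_right h, hrt⟩, by simp⟩
  | succ n ih =>
    obtain ⟨m, hm, hmt⟩ := h
    rcases lt_or_ge (ρ r) (ρ m) with hrm | hmr
    · obtain ⟨a, b, ha, hb, hab⟩ := ih hm hrm
      exact ⟨a, b + 1, ha, R.gap_far hb hmt, by push_cast; omega⟩
    · exact ⟨Int.ofNat (n + 1), 0, R.gap_le (a := Int.ofNat (n + 1)) hm hr hmr,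
        ⟨hr, R.mem_right hmt, hrt⟩, by simp⟩

theorem near_split (R : IsRankedSemiorder A ρ far) {n : ℕ} {s t r : V} (h : stepRel
    (NearRel A far) n s t) (hr : r ∈ A)
    (htr : ρ t ≤ ρ r) (hrs : ρ r ≤ ρ s) :
    ∃ p q : ℕ, stepRel (NearRel A far) p s r ∧ stepRel (NearRel A far) q r t ∧ p + q ≤ n := by
  induction n generalizing t with
  | zero => exact ⟨0, 0, R.near_le h hr htr, R.le_near hr hrs h, le_rfl⟩
  | succ n ih =>
    obtain ⟨m, hm, hmt⟩ := h
    rcases lt_or_ge (ρ r) (ρ m) with hrm | hmr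
    · exact ⟨n + 1, 0, ⟨m, hm, R.near_le hmt hr htr⟩, R.le_near hr hrm.le hmt, by simp⟩
    · obtain ⟨p, q, hp, hq, hpq⟩ := ih hm hmr
      exact ⟨p, q + 1, hp, ⟨m, hq, hmt⟩, by omega⟩

/-- Splitting a lower bound at an intermediate element loses at most one. -/
theorem gap_split (R : IsRankedSemiorder A ρ far) {a : ℤ} {s t r : V} (h : Gap A ρ far a s t)
    (hr : r ∈ A)
    (hbt : (ρ s ≤ ρ r ∧ ρ r ≤ ρ t) ∨ (ρ t ≤ ρ r ∧ ρ r ≤ ρ s)) :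
    ∃ b c : ℤ, Gap A ρ far b s r ∧ Gap A ρ far c r t ∧ a ≤ b + c + 1 := by
  obtain ⟨hs, ht⟩ := R.gap_mem h
  rcases hbt with ⟨hsr, hrt⟩ | ⟨htr, hrs⟩
  · rcases hrt.lt_or_eq with hrt | hrt
    · rcases hsr.lt_or_eq with hsr | hsr
      · match a, h with
        | Int.ofNat 0, h => exact ⟨0, 0, ⟨hs, hr, hsr⟩, ⟨hr, ht, hrt⟩, by simp⟩
        | Int.ofNat (n + 1), h =>
          obtain ⟨b, c, hb, hc, hbc⟩ := R.far_split h hr hsr hrt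
          exact ⟨b, c, hb, hc, by simp only [Int.ofNat_eq_natCast]; omega⟩
        | Int.negSucc n, h => exact ⟨0, 0, ⟨hs, hr, hsr⟩, ⟨hr, ht, hrt⟩, by omega⟩
      · exact ⟨-1, a, (R.near_of_le hs hr hsr.le).gap, R.le_gap hr hsr.ge h, by omega⟩
    · exact ⟨a, -1, R.gap_le h hr hrt.ge, (R.near_of_le hr ht hrt.le).gap, by omega⟩
  · have ha : a < 0 := by
      by_contra! ha
      have := (R.gap_rank ha h).2
      omega
    match a, h with
    | Int.negSucc n, h =>
      obtain ⟨p, q, hp, hq, hpq⟩ := R.near_split h hr htr hrs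
      exact ⟨Int.negSucc p, Int.negSucc q, hp, hq, by omega⟩

end IsRankedSemiorder

end Semiorder

/-! ### Strict systems of difference constraints -/

/-- A strict integer difference system that is solved on `A` can be solved on one further vertex
`t` if the constraints through `t` are dominated by constraints on `A`. -/
theorem exists_extend_solution [Finite V] (C : ℤ → V → V → Prop) (B : ℤ)
    (hB : ∀ a u v, C a u v → a ≤ B) (A : Set V) (t : V) (htt : ∀ a, C a t t → a < 0)
    (hC : ∀ a b, ∀ s ∈ A, ∀ r ∈ A, C a s t → C b t r → ∃ c, a + b ≤ c ∧ C c s r)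
    (x : V → ℝ) (hx : ∀ a, ∀ s ∈ A, ∀ r ∈ A, C a s r → x s + a < x r) :
    ∃ y : V → ℝ, ∀ a, ∀ s ∈ insert t A, ∀ r ∈ insert t A, C a s r → y s + a < y r := by
  classical
  by_cases htA : t ∈ A
  · exact ⟨x, by rwa [Set.insert_eq_of_mem htA]⟩
  have greatest : ∀ u v a, C a u v → ∃ m, a ≤ m ∧ C m u v ∧ ∀ z, C z u v → z ≤ m := by
    intro u v a ha
    obtain ⟨m, hm, hmax⟩ := Int.exists_greatest_of_bdd ⟨B, fun z hz => hB z u v hz⟩ ⟨a, ha⟩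
    exact ⟨m, hmax a ha, hm, hmax⟩
  have finite_greatest : ∀ u v, {m : ℤ | C m u v ∧ ∀ z, C z u v → z ≤ m}.Finite := fun u v =>
    Set.Subsingleton.finite fun m hm n hn => le_antisymm (hn.2 m hm.1) (hm.2 n hn.1)
  have lower_fin : (⋃ s ∈ A, (fun m : ℤ => x s + m) ''
      {m : ℤ | C m s t ∧ ∀ z, C z s t → z ≤ m}).Finite :=
    A.toFinite.biUnion fun s _ => (finite_greatest s t).image _
  have upper_fin : (⋃ r ∈ A, (fun m : ℤ => x r - m) ''
      {m : ℤ | C m t r ∧ ∀ z, C z t r → z ≤ m}).Finite :=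
    A.toFinite.biUnion fun r _ => (finite_greatest t r).image _
  obtain ⟨p, hlo, hhi⟩ := Order.exists_between_finsets
    (lo := lower_fin.toFinset) (hi := upper_fin.toFinset) (by
      intro l hl h hh
      simp only [Set.Finite.mem_toFinset, Set.mem_iUnion, Set.mem_image] at hl hh
      obtain ⟨s, hs, a, ⟨ha, -⟩, rfl⟩ := hl
      obtain ⟨r, hr, b, ⟨hb, -⟩, rfl⟩ := hh
      obtain ⟨c, hc, hcs⟩ := hC a b s hs r hr ha hb
      have h1 := hx c s hs r hr hcs
      have h2 : (a : ℝ) + b ≤ c := by exact_mod_cast hc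
      linarith)
  have ne_t : ∀ s ∈ A, s ≠ t := fun s hs h => htA (h ▸ hs)
  refine ⟨Function.update x t p, ?_⟩
  rintro a s (rfl | hs) r (rfl | hr) h
  · have : (a : ℝ) < 0 := by exact_mod_cast htt a h
    linarith
  · rw [Function.update_self, Function.update_of_ne (ne_t r hr)]
    obtain ⟨m, ham, hm, hmax⟩ := greatest _ _ _ h
    have h1 := hhi (x r - m) (by
      simp only [Set.Finite.mem_toFinset, Set.mem_iUnion, Set.mem_image]
      exact ⟨r, hr, m, ⟨hm, hmax⟩, rfl⟩)
    have h2 : (a : ℝ) ≤ m := by exact_mod_cast ham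
    linarith
  · rw [Function.update_self, Function.update_of_ne (ne_t s hs)]
    obtain ⟨m, ham, hm, hmax⟩ := greatest _ _ _ h
    have h1 := hlo (x s + m) (by
      simp only [Set.Finite.mem_toFinset, Set.mem_iUnion, Set.mem_image]
      exact ⟨s, hs, m, ⟨hm, hmax⟩, rfl⟩)
    have h2 : (a : ℝ) ≤ m := by exact_mod_cast ham
    linarith
  · rw [Function.update_of_ne (ne_t s hs), Function.update_of_ne (ne_t r hr)]
    exact hx a s hs r hr h

/-- A family of ranked semiorders that pairwise overlap in `T` only, are ranked consistently on `T`,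
and have no contradictory pair of bounds on `T`, admits a common solution of all bounds. -/
theorem exists_common_solution [Finite V] {ι : Type*} (A : ι → Set V) (T : Set V)
    (κ : V → ℕ) (hκ : Function.Injective κ) (ρ : ι → V → ℕ) (far : ι → V → V → Prop)
    (B : ℕ) (hB : ∀ i v, ρ i v ≤ B) (R : ∀ i, IsRankedSemiorder (A i) (ρ i) (far i))
    (hTA : ∀ i, T ⊆ A i) (hA : ∀ i j, i ≠ j → A i ∩ A j ⊆ T)
    (hρ : ∀ i, ∀ u ∈ T, ∀ v ∈ T, κ u ≤ κ v → ρ i u ≤ ρ i v)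
    (hT : ∀ i j a b, ∀ u ∈ T, ∀ v ∈ T, Gap (A i) (ρ i) (far i) a u v →
      Gap (A j) (ρ j) (far j) b v u → a + b < 0) :
    ∃ x : V → ℝ, ∀ i a u v, Gap (A i) (ρ i) (far i) a u v → x u + a < x v := by
  classical
  have := Fintype.ofFinite V
  set C : ℤ → V → V → Prop := fun a u v => ∃ i, Gap (A i) (ρ i) (far i) a u v
  have bound : ∀ a u v, C a u v → a ≤ (B : ℤ) := by
    rintro a u v ⟨i, h⟩
    by_contra! ha
    have h1 := ((R i).gap_rank (by omega) h).1
    have h2 := hB i v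
    omega
  have self_neg : ∀ t a, C a t t → a < 0 := by
    rintro t a ⟨i, h⟩
    have := (R i).gap_self_neg h
    omega
  have shared : ∀ n : ℕ, ∃ x : V → ℝ, ∀ a, ∀ s ∈ {v ∈ T | κ v < n}, ∀ r ∈ {v ∈ T | κ v < n},
      C a s r → x s + a < x r := by
    intro n
    induction n with
    | zero => exact ⟨0, fun a s hs => absurd hs.2 (by simp)⟩
    | succ n ih =>
      obtain ⟨x, hx⟩ := ih
      by_cases hn : ∃ t ∈ T, κ t = n
      · obtain ⟨t, htT, rfl⟩ := hn
        obtain ⟨y, hy⟩ := exists_extend_solution C B bound _ t (self_neg t) (by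
          rintro a b s ⟨hs, hst⟩ r ⟨hr, hrt⟩ ⟨i, hi⟩ ⟨j, hj⟩
          rcases le_total (κ r) (κ s) with hrs | hsr
          · obtain ⟨b', c, hb', hc, hle⟩ := (R j).gap_split hj (hTA j hs)
              (Or.inr ⟨hρ j r hr s hs hrs, hρ j s hs t htT hst.le⟩)
            have := hT i j a b' s hs t htT hi hb'
            exact ⟨c, by omega, j, hc⟩
          · obtain ⟨a', c, ha', hc, hle⟩ := (R i).gap_split hi (hTA i hr)
              (Or.inl ⟨hρ i s hs r hr hsr, hρ i r hr t htT hrt.le⟩)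
            have := hT i j c b r hr t htT hc hj
            exact ⟨a', by omega, i, ha'⟩) x hx
        have key : ∀ v ∈ {v ∈ T | κ v < κ t + 1}, v ∈ insert t {v ∈ T | κ v < κ t} := by
          rintro v ⟨hv, hvt⟩
          rcases (Nat.lt_succ_iff.1 hvt).lt_or_eq with h | h
          · exact Or.inr ⟨hv, h⟩
          · exact Or.inl (hκ h)
        exact ⟨y, fun a s hs r hr => hy a s (key s hs) r (key r hr)⟩
      · have key : ∀ v ∈ {v ∈ T | κ v < n + 1}, v ∈ {v ∈ T | κ v < n} := by
          rintro v ⟨hv, hvn⟩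
          exact ⟨hv, lt_of_le_of_ne (Nat.lt_succ_iff.1 hvn) fun h => hn ⟨v, hv, h⟩⟩
        exact ⟨x, fun a s hs r hr => hx a s (key s hs) r (key r hr)⟩
  have extended : ∀ F : Finset V, ∃ x : V → ℝ, ∀ a, ∀ s ∈ T ∪ (F : Set V), ∀ r ∈ T ∪ (F : Set V),
      C a s r → x s + a < x r := by
    intro F
    induction F using Finset.induction_on with
    | empty =>
      obtain ⟨x, hx⟩ := shared (Finset.univ.sup κ + 1)
      have key : ∀ v ∈ T ∪ ((∅ : Finset V) : Set V), v ∈ {v ∈ T | κ v < Finset.univ.sup κ + 1} := by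
        intro v hv
        exact ⟨by simpa using hv, Nat.lt_succ_iff.2 (Finset.le_sup (Finset.mem_univ v))⟩
      exact ⟨x, fun a s hs r hr => hx a s (key s hs) r (key r hr)⟩
    | insert t F _ ih =>
      obtain ⟨x, hx⟩ := ih
      rw [Finset.coe_insert, Set.union_insert]
      by_cases htT : t ∈ T
      · exact ⟨x, by rwa [Set.insert_eq_of_mem (Set.mem_union_left _ htT)]⟩
      · refine exists_extend_solution C B bound _ t (self_neg t) ?_ x hx
        rintro a b s - r - ⟨i, hi⟩ ⟨j, hj⟩
        obtain rfl : i = j := by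
          by_contra hij
          exact htT (hA i j hij ⟨((R i).gap_mem hi).2, ((R j).gap_mem hj).1⟩)
        exact ⟨a + b, le_rfl, i, (R i).gap_trans hi hj⟩
  obtain ⟨x, hx⟩ := extended Finset.univ
  exact ⟨x, fun i a u v h => hx a u (by simp) v (by simp) ⟨i, h⟩⟩

/-! ### Straight enumerations -/

theorem GraphOn.SameBlock.adj {G : GraphOn V} {u v : V} (h : G.SameBlock u v) (huv : u ≠ v) :
    G.Adj u v :=
  ((h.2.2 v).2 (Or.inr rfl)).resolve_right huv

namespace StraightEnum

variable {G : GraphOn V} (σ : StraightEnum G)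

theorem not_lt {u v : V} (hu : u ∈ G.verts) (hv : v ∈ G.verts) : ¬ σ.lt u v ↔ σ.le v u := by
  have := σ.total u hu v hv
  unfold lt
  tauto

theorem lt_of_lt_of_le {u v w : V} (hu : u ∈ G.verts) (hv : v ∈ G.verts) (hw : w ∈ G.verts)
    (h : σ.lt u v) (h' : σ.le v w) : σ.lt u w :=
  ⟨σ.trans u hu v hv w hw h.1 h', fun h'' => h.2 (σ.trans v hv w hw u hu h' h'')⟩

theorem lt_of_le_of_lt {u v w : V} (hu : u ∈ G.verts) (hv : v ∈ G.verts) (hw : w ∈ G.verts)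
    (h : σ.le u v) (h' : σ.lt v w) : σ.lt u w :=
  ⟨σ.trans u hu v hv w hw h h'.1, fun h'' => h'.2 (σ.trans w hw u hu v hv h'' h)⟩

theorem ne_of_lt {u v : V} (h : σ.lt u v) : u ≠ v := by
  rintro rfl
  exact h.2 h.1

theorem lt_of_le_of_not_adj {u v : V} (hu : u ∈ G.verts) (hv : v ∈ G.verts) (huv : u ≠ v)
    (h : σ.le u v) (hadj : ¬ G.Adj u v) : σ.lt u v :=
  ⟨h, fun h' => hadj (((σ.eq_block u hu v hv).1 ⟨h, h'⟩).adj huv)⟩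

theorem adj_of_adj {u v w : V} (hu : u ∈ G.verts) (hv : v ∈ G.verts) (hw : w ∈ G.verts)
    (huv : σ.le u v) (hvw : σ.le v w) (h : G.Adj u w) :
    (u ≠ v → G.Adj u v) ∧ (v ≠ w → G.Adj v w) := by
  obtain ⟨h1, h2⟩ := σ.straight u hu v hv w hw huv hvw (Or.inl h)
  exact ⟨fun hne => h1.elim id fun hb => hb.adj hne, fun hne => h2.elim id fun hb => hb.adj hne⟩

/-- A ranking of the vertices refining `σ` turns the ordered non-edges into a semiorder. -/
theorem isRankedSemiorder {ρ : V → ℕ}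
    (hρ : ∀ u ∈ G.verts, ∀ v ∈ G.verts, σ.lt u v → ρ u < ρ v) :
    IsRankedSemiorder G.verts ρ
      (fun u v => u ∈ G.verts ∧ v ∈ G.verts ∧ ρ u < ρ v ∧ ¬ G.Adj u v) := by
  have hle : ∀ {u v}, u ∈ G.verts → v ∈ G.verts → ρ u ≤ ρ v → σ.le u v := fun hu hv h =>
    (σ.not_lt hv hu).1 fun h' => absurd (hρ _ hv _ hu h') (by omega)
  refine ⟨fun h => h.1, fun h => h.2.1, fun h => h.2.2.1, ?_, ?_⟩
  · rintro u v w ⟨hu, hv, huv, hadj⟩ hw hvw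
    refine ⟨hu, hw, by omega, fun h => hadj ?_⟩
    exact (σ.adj_of_adj hu hv hw (hle hu hv huv.le) (hle hv hw hvw) h).1 (by rintro rfl; omega)
  · rintro u v w hu huv ⟨hv, hw, hvw, hadj⟩
    refine ⟨hu, hw, by omega, fun h => hadj ?_⟩
    exact (σ.adj_of_adj hu hv hw (hle hu hv huv) (hle hv hw hvw.le) h).2 (by rintro rfl; omega)

theorem isChainSeq_pair {u v : V} (h : σ.lt u v) (hadj : G.Adj u v) : IsChainSeq G σ u v 2 := by
  refine ⟨fun t => if t = 0 then u else v, by simp, by simp, fun t _ => ?_, fun s t hst ht => ?_,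
    fun t ht => ?_⟩
  · dsimp only
    split_ifs
    exacts [(G.mem_of_adj hadj).1, (G.mem_of_adj hadj).2]
  · obtain ⟨rfl, rfl⟩ : s = 0 ∧ t = 1 := by omega
    simpa using h
  · obtain rfl : t = 0 := by omega
    simpa using hadj

theorem isChainSeq_cons {s u v : V} {l : ℕ} (hl : 2 ≤ l) (h : σ.lt s u) (hadj : G.Adj s u)
    (hc : IsChainSeq G σ u v l) : IsChainSeq G σ s v (l + 1) := by
  obtain ⟨c, rfl, rfl, hmem, hlt, hstep⟩ := hc
  have hs := (G.mem_of_adj hadj).1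
  refine ⟨fun t => Nat.casesOn t s c, rfl, ?_, ?_, ?_, ?_⟩
  · obtain ⟨n, rfl⟩ : ∃ n, l = n + 1 := ⟨l - 1, by omega⟩
    rfl
  · rintro (_ | t) ht
    exacts [hs, hmem t (by omega)]
  · rintro (_ | p) (_ | t) hpt ht
    · omega
    · rcases Nat.eq_zero_or_pos t with rfl | h0
      · exact h
      · exact σ.lt_of_lt_of_le hs (hmem 0 (by omega)) (hmem t (by omega)) h
          (hlt 0 t h0 (by omega)).1
    · omega
    · exact hlt p t (by omega) (by omega)
  · rintro (_ | t) ht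
    exacts [hadj, hstep t (by omega)]

theorem exists_isChainSeq {n : ℕ} {s t : V}
    (h : stepRel (fun u v => u ∈ G.verts ∧ v ∈ G.verts ∧ (σ.le u v ∨ G.Adj u v)) n t s)
    (hst : σ.lt s t) : ∃ l, 2 ≤ l ∧ l ≤ n + 2 ∧ IsChainSeq G σ s t l := by
  induction n generalizing s with
  | zero =>
    exact ⟨2, le_rfl, le_rfl,
      σ.isChainSeq_pair hst (G.symm (h.2.2.resolve_left hst.2))⟩
  | succ n ih =>
    obtain ⟨x, hx, hxm, hsm, hor⟩ := h
    have htm : t ∈ G.verts := by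
      clear ih hor hst
      induction n generalizing x with
      | zero => exact hx.1
      | succ n ih' => obtain ⟨y, hy, hyx⟩ := hx; exact ih' y hy hyx.1
    by_cases hxs : σ.le x s
    · have hx' := stepRel_absorb_right (w := s) (fun u hu => by
        refine ⟨hu.1, hsm, ?_⟩
        by_cases hus : σ.le u s
        · exact Or.inl hus
        · have hsu := (σ.total u hu.1 s hsm).resolve_left hus
          rcases hu.2.2 with h | h
          · exact absurd (σ.trans u hu.1 x hxm s hsm h hxs) hus
          · refine Or.inr (G.symm ((σ.adj_of_adj hxm hsm hu.1 hxs hsu (G.symm h)).2 ?_))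
            rintro rfl
            exact hus (σ.refl _ hsm)) hx
      obtain ⟨l, h1, h2, h3⟩ := ih hx' hst
      exact ⟨l, h1, by omega, h3⟩
    · have hsx : σ.lt s x := ⟨(σ.total s hsm x hxm).resolve_right hxs, hxs⟩
      have hadj : G.Adj s x := G.symm (hor.resolve_left hxs)
      by_cases hxt : σ.lt x t
      · obtain ⟨l, h1, h2, h3⟩ := ih hx hxt
        exact ⟨l + 1, by omega, by omega, σ.isChainSeq_cons h1 hsx hadj h3⟩
      · have htx := (σ.not_lt hxm htm).1 hxt
        exact ⟨2, le_rfl, by omega, σ.isChainSeq_pair hst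
          ((σ.adj_of_adj hsm htm hxm hst.1 htx hadj).1 (σ.ne_of_lt hst))⟩

theorem isBarSeq_of_stepRel {far : V → V → Prop} (hmem : ∀ u v, far u v → u ∈ G.verts ∧ v ∈ G.verts)
    (htrans : ∀ u v w, far u v → far v w → far u w) (hlt : ∀ u v, far u v → σ.lt u v)
    (hadj : ∀ u v, far u v → ¬ G.Adj u v) {n : ℕ} {s t : V} (h : stepRel far n s t) :
    IsBarSeq G σ s t (n + 2) := by
  obtain ⟨b, h0, hn, hb⟩ := stepRel_exists_seq h
  have key : ∀ p d, p + d + 1 ≤ n + 1 → far (b p) (b (p + d + 1)) := by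
    intro p d hd
    induction d with
    | zero => exact hb p (by omega)
    | succ d ih => exact htrans _ _ _ (ih (by omega)) (hb (p + d + 1) (by omega))
  have hfar : ∀ p q, p < q → q < n + 2 → far (b p) (b q) := by
    intro p q hpq hq
    obtain ⟨d, rfl⟩ : ∃ d, q = p + d + 1 := ⟨q - p - 1, by omega⟩
    exact key p d (by omega)
  refine ⟨b, h0, hn, ?_, fun p q hpq hq => hlt _ _ (hfar p q hpq hq), fun p q hp hq hne => ?_⟩
  · rintro (_ | q) hq
    · exact (hmem _ _ (hfar 0 1 (by omega) (by omega))).1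
    · exact (hmem _ _ (hfar q (q + 1) (by omega) hq)).2
  · rcases Nat.lt_or_gt_of_ne hne with h | h
    · exact hadj _ _ (hfar p q h hq)
    · exact fun h' => hadj _ _ (hfar q p h hp) (G.symm h')

end StraightEnum

/-- A transitive irreflexive relation on a finite type is refined by a rank function. -/
theorem exists_rank [Fintype V] (r : V → V → Prop) (P : Set V) (hirr : ∀ u ∈ P, ¬ r u u)
    (htrans : ∀ u ∈ P, ∀ v ∈ P, ∀ w ∈ P, r u v → r v w → r u w) :
    ∃ f : V → ℕ, (∀ u ∈ P, ∀ v ∈ P, r u v → f u < f v) ∧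
      (∀ u ∈ P, ∀ v ∈ P, (∀ w ∈ P, r w u → r w v) → f u ≤ f v) := by
  classical
  refine ⟨fun v => (Finset.univ.filter fun w => w ∈ P ∧ r w v).card, fun u hu v hv huv => ?_,
    fun u hu v hv h => ?_⟩
  · refine Finset.card_lt_card (Finset.ssubset_iff_of_subset ?_ |>.2 ⟨u, ?_, ?_⟩)
    · intro w
      simp only [Finset.mem_filter, Finset.mem_univ, true_and]
      exact fun hw => ⟨hw.1, htrans w hw.1 u hu v hv hw.2 huv⟩
    · simpa using ⟨hu, huv⟩
    · simpa [hu] using hirr u hu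
  · refine Finset.card_le_card fun w => ?_
    simp only [Finset.mem_filter, Finset.mem_univ, true_and]
    exact fun hw => ⟨hw.1, h w hw.1 hw.2⟩

/-- Ranks of the shared vertices and of the single graphs that refine a simultaneous enumeration and
agree on the shared vertices. -/
theorem exists_consistent_ranks [Fintype V] {k : ℕ} {G : Fin k → GraphOn V} {S : GraphOn V}
    (hS : ∀ i, S.verts ⊆ (G i).verts) (ζ : ∀ i, StraightEnum (G i)) (hζ : IsSimEnum G S ζ) :
    ∃ (κ : V → ℕ) (ρ : Fin k → V → ℕ), Function.Injective κ ∧ (∀ i, Function.Injective (ρ i)) ∧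
      (∀ i, ∀ u ∈ (G i).verts, ∀ v ∈ (G i).verts, (ζ i).lt u v → ρ i u < ρ i v) ∧
      (∀ i, ∀ u ∈ S.verts, ∀ v ∈ S.verts, κ u ≤ κ v → ρ i u ≤ ρ i v) := by
  classical
  obtain ⟨f, hf, -⟩ := exists_rank (fun u v => ∃ i, (ζ i).lt u v) S.verts
    (fun u _ ⟨_, h⟩ => h.2 h.1) (by
      rintro u hu v hv w hw ⟨i, hi⟩ ⟨j, hj⟩
      exact ⟨j, (ζ j).lt_of_le_of_lt (hS j hu) (hS j hv) (hS j hw) (hζ i j u hu v hv hi) hj⟩)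
  choose g hg hg' using fun i => exists_rank (ζ i).lt (G i).verts
    (fun u _ h => h.2 h.1)
    (fun u hu v hv w hw h h' => (ζ i).lt_of_lt_of_le hu hv hw h h'.1)
  set e := Fintype.equivFin V
  -- lexicographic combination of a primary and a secondary rank
  have lex_lt : ∀ {N a b c d : ℕ}, a < b → c < N → a * N + c < b * N + d := by
    intro N a b c d hab hc
    have := Nat.mul_le_mul_right N (show a + 1 ≤ b from hab)
    rw [Nat.add_mul] at this
    omega
  have lex_inj : ∀ {N a b c d : ℕ}, c < N → d < N → a * N + c = b * N + d → c = d := by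
    intro N a b c d hc hd h
    rcases lt_trichotomy a b with hab | rfl | hab
    · exact absurd h (lex_lt hab hc).ne
    · omega
    · exact absurd h (lex_lt hab hd).ne'
  set κ : V → ℕ := fun v => f v * Fintype.card V + e v
  have hκinj : Function.Injective κ := fun u v h =>
    e.injective (Fin.ext (lex_inj (e u).2 (e v).2 h))
  set N := Finset.univ.sup κ + 1
  have hκN : ∀ v, κ v < N := fun v => Nat.lt_succ_iff.2 (Finset.le_sup (Finset.mem_univ v))
  refine ⟨κ, fun i v => g i v * N + κ v, hκinj,
    fun i u v h => hκinj (lex_inj (hκN u) (hκN v) h),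
    fun i u hu v hv h => lex_lt (hg i u hu v hv h) (hκN u), fun i u hu v hv h => ?_⟩
  have hle : (ζ i).le u v := by
    refine ((ζ i).not_lt (hS i hv) (hS i hu)).1 fun hlt => ?_
    have : κ v < κ u := lex_lt (hf v hv u hu ⟨i, hlt⟩) (e v).2
    omega
  have := hg' i u (hS i hu) v (hS i hv) fun w hw hwu =>
    (ζ i).lt_of_lt_of_le hw (hS i hu) (hS i hv) hwu hle
  exact Nat.add_le_add (Nat.mul_le_mul_right N this) h

/-! ### Unit interval representations -/

theorem GraphOn.IsUnitRep.adj_iff {G : GraphOn V} {I : V → ℝ × ℝ} (hI : G.IsUnitRep I) {u v : V}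
    (hu : u ∈ G.verts) (hv : v ∈ G.verts) (h : (I u).1 < (I v).1) :
    G.Adj u v ↔ (I v).1 ≤ (I u).1 + 1 := by
  have hne : u ≠ v := by rintro rfl; exact lt_irrefl _ h
  rw [← hI.1.2 u hu v hv hne, ivl, ivl, Set.Icc_inter_Icc, Set.nonempty_Icc, hI.2 u hu, hI.2 v hv,
    sup_eq_right.2 h.le, le_inf_iff]
  exact ⟨fun h => h.1, fun h' => ⟨h', by linarith⟩⟩

/-- A solution of the distance constraints of a graph is a unit interval representation. -/
theorem isUnitRep_of_dist {G : GraphOn V} {x : V → ℝ} {ρ : V → ℕ} (hρ : Function.Injective ρ)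
    (hfar : ∀ u ∈ G.verts, ∀ v ∈ G.verts, ρ u < ρ v → ¬ G.Adj u v → x u + 1 < x v)
    (hnear : ∀ u ∈ G.verts, ∀ v ∈ G.verts, G.Adj u v → x u ≤ x v + 1) :
    G.IsUnitRep fun v => (x v, x v + 1) := by
  refine ⟨⟨fun v _ => by simp, fun u hu v hv hne => ?_⟩, fun v _ => rfl⟩
  rw [ivl, ivl, Set.Icc_inter_Icc, Set.nonempty_Icc, sup_le_iff, le_inf_iff, le_inf_iff]
  constructor
  · rintro ⟨⟨-, h1⟩, h2, -⟩
    by_contra hadj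
    rcases lt_or_gt_of_ne (hρ.ne hne) with h | h
    · have := hfar u hu v hv h hadj
      dsimp only at h1 h2
      linarith
    · have := hfar v hv u hu h fun h' => hadj (G.symm h')
      dsimp only at h1 h2
      linarith
  · intro h
    have h1 := hnear u hu v hv h
    have h2 := hnear v hv u hu (G.symm h)
    dsimp only
    exact ⟨⟨by linarith, h1⟩, h2, by linarith⟩

theorem not_hasConflict_of_realizes {k : ℕ} {G : Fin k → GraphOn V} {S : GraphOn V}
    {ζ : ∀ i, StraightEnum (G i)} {I : V → ℝ × ℝ} (hI : ∀ i, (G i).IsUnitRep I)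
    (hR : ∀ i, Realizes (G i) I (ζ i)) : ¬ HasConflict G S ζ := by
  rintro ⟨u, -, v, -, -, i, j, l, hl, ⟨c, hc0, hcl, hcm, hclt, hcadj⟩, m, hlm,
    ⟨b, hb0, hbl, hbm, hblt, hbadj⟩⟩
  have chain : ∀ t, t < l → (I (c t)).1 ≤ (I (c 0)).1 + t := by
    intro t
    induction t with
    | zero => simp
    | succ t ih =>
      intro ht
      have h1 := ih (by omega)
      have h2 := hR i _ (hcm t (by omega)) _ (hcm _ ht) (hclt t (t + 1) (by omega) ht)
      have h3 := ((hI i).adj_iff (hcm t (by omega)) (hcm _ ht) h2).1 (hcadj t ht)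
      push_cast
      linarith
  have bar : ∀ t, t + 1 < m → (I (b 0)).1 + (t + 1) < (I (b (t + 1))).1 := by
    have step : ∀ t, t + 1 < m → (I (b t)).1 + 1 < (I (b (t + 1))).1 := by
      intro t ht
      have h2 := hR j _ (hbm t (by omega)) _ (hbm _ ht) (hblt t (t + 1) (by omega) ht)
      by_contra! h
      exact hbadj t (t + 1) (by omega) ht (by omega)
        (((hI j).adj_iff (hbm t (by omega)) (hbm _ ht) h2).2 h)
    intro t
    induction t with
    | zero => simpa using step 0
    | succ t ih =>
      intro ht
      have h1 := ih (by omega)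
      have h2 := step (t + 1) ht
      push_cast
      linarith
  have h1 := chain (l - 1) (by omega)
  have h2 := bar (m - 2) (by omega)
  rw [show m - 2 + 1 = m - 1 by omega, hbl, hb0] at h2
  rw [hcl, hc0] at h1
  have h3 : ((l - 1 : ℕ) : ℝ) ≤ ((m - 2 : ℕ) : ℝ) + 1 := by
    exact_mod_cast (show l - 1 ≤ m - 2 + 1 by omega)
  linarith

theorem exists_realization_of_not_hasConflict [Fintype V] {k : ℕ} {G : Fin k → GraphOn V}
    {S : GraphOn V} (hsun : IsSunflower G S) {ζ : ∀ i, StraightEnum (G i)}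
    (hζ : IsSimEnum G S ζ) (hnc : ¬ HasConflict G S ζ) :
    ∃ I : V → ℝ × ℝ, (∀ i, (G i).IsUnitRep I) ∧ ∀ i, Realizes (G i) I (ζ i) := by
  have hS : ∀ i, S.verts ⊆ (G i).verts := fun i => (hsun.1 i).1
  obtain ⟨κ, ρ, hκ, hρ, hζρ, hκρ⟩ := exists_consistent_ranks hS ζ hζ
  set far : Fin k → V → V → Prop := fun i u v =>
    u ∈ (G i).verts ∧ v ∈ (G i).verts ∧ ρ i u < ρ i v ∧ ¬ (G i).Adj u v
  have R : ∀ i, IsRankedSemiorder (G i).verts (ρ i) (far i) := fun i =>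
    (ζ i).isRankedSemiorder (hζρ i)
  have hle : ∀ i, ∀ u ∈ (G i).verts, ∀ v ∈ (G i).verts, ρ i u ≤ ρ i v → (ζ i).le u v :=
    fun i u hu v hv h => ((ζ i).not_lt hv hu).1 fun h' => absurd (hζρ i v hv u hu h') (by omega)
  have far_lt : ∀ i u v, far i u v → (ζ i).lt u v := fun i u v h =>
    (ζ i).lt_of_le_of_not_adj h.1 h.2.1 (by rintro rfl; exact lt_irrefl _ h.2.2.1)
      (hle i u h.1 v h.2.1 h.2.2.1.le) h.2.2.2
  have no_bar_chain : ∀ i j n m, ∀ u ∈ S.verts, ∀ v ∈ S.verts, stepRel (far i) n u v →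
      stepRel (NearRel (G j).verts (far j)) m v u → n < m := by
    intro i j n m u hu v hv hbar hchain
    by_contra! hmn
    have huv := (R i).stepRel_far hbar
    have hne : u ≠ v := (ζ i).ne_of_lt (far_lt i u v huv)
    have hltj : (ζ j).lt u v :=
      (ζ j).lt_of_le_of_not_adj (hS j hu) (hS j hv) hne (hζ i j u hu v hv (far_lt i u v huv))
        fun h => huv.2.2.2 (((hsun.1 i).2 u hu v hv).1 (((hsun.1 j).2 u hu v hv).2 h))
    obtain ⟨l, h2l, hlm, hl⟩ := (ζ j).exists_isChainSeq (stepRel_mono (fun a b h => by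
      refine ⟨h.1, h.2.1, ?_⟩
      by_contra! hcon
      have hlt : ρ j b < ρ j a := by
        by_contra! hab
        exact hcon.1 (hle j a h.1 b h.2.1 hab)
      exact h.2.2 ⟨h.2.1, h.1, hlt, fun h' => hcon.2 ((G j).symm h')⟩) hchain) hltj
    refine hnc ⟨u, hu, v, hv, hne, j, i, l, h2l, hl, n + 2, by omega, ?_⟩
    exact (ζ i).isBarSeq_of_stepRel (far := far i) (fun _ _ h => ⟨h.1, h.2.1⟩)
      (fun _ _ _ h h' => (R i).far_le h h'.2.1 h'.2.2.1.le) (far_lt i)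
      (fun _ _ h => h.2.2.2) hbar
  have rank_lt : ∀ i a, ∀ u ∈ S.verts, ∀ v ∈ S.verts, 0 ≤ a →
      Gap (G i).verts (ρ i) (far i) a u v → κ u < κ v := by
    intro i a u hu v hv ha h
    by_contra! hcon
    have h1 := ((R i).gap_rank ha h).2
    have h2 := hκρ i v hv u hu hcon
    omega
  have no_contradiction : ∀ i j a b, ∀ u ∈ S.verts, ∀ v ∈ S.verts,
      Gap (G i).verts (ρ i) (far i) a u v → Gap (G j).verts (ρ j) (far j) b v u → a + b < 0 := by
    intro i j a b u hu v hv ha hb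
    match a, b, ha, hb with
    | Int.ofNat p, Int.ofNat q, ha, hb =>
      have h1 := rank_lt i _ u hu v hv (Int.natCast_nonneg p) ha
      have h2 := rank_lt j _ v hv u hu (Int.natCast_nonneg q) hb
      omega
    | Int.negSucc p, Int.negSucc q, _, _ => omega
    | Int.ofNat 0, Int.negSucc q, _, _ => simp only [Int.ofNat_eq_natCast]; omega
    | Int.negSucc q, Int.ofNat 0, _, _ => simp only [Int.ofNat_eq_natCast]; omega
    | Int.ofNat (n + 1), Int.negSucc m, ha, hb =>
      have := no_bar_chain i j n m u hu v hv ha hb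
      simp only [Int.ofNat_eq_natCast]
      omega
    | Int.negSucc m, Int.ofNat (n + 1), ha, hb =>
      have := no_bar_chain j i n m v hv u hu hb ha
      simp only [Int.ofNat_eq_natCast]
      omega
  obtain ⟨x, hx⟩ := exists_common_solution (fun i => (G i).verts) S.verts κ hκ ρ far
    (Finset.univ.sup fun i => Finset.univ.sup (ρ i))
    (fun i v => (Finset.le_sup (f := ρ i) (Finset.mem_univ v)).trans
      (Finset.le_sup (f := fun i => Finset.univ.sup (ρ i)) (Finset.mem_univ i)))
    R hS (fun i j hij => ((hsun.2 i j hij).1).subset) hκρ no_contradiction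
  refine ⟨fun v => (x v, x v + 1), fun i => isUnitRep_of_dist (hρ i) ?_ ?_, fun i u hu v hv h => ?_⟩
  · intro u hu v hv huv hadj
    simpa using hx i 1 u v ⟨hu, hv, huv, hadj⟩
  · intro u hu v hv hadj
    have := hx i (-1) u v
      (NearRel.gap ⟨hu, hv, fun h => h.2.2.2 ((G i).symm hadj)⟩)
    push_cast at this
    linarith
  · simpa using hx i 0 u v ⟨hu, hv, hζρ i u hu v hv h⟩

/-- A sunflower proper interval graph with simultaneous enumeration
`ζ` has a simultaneous unit interval representation realizing `ζ` iff it has no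
conflict for `ζ`. -/
theorem simUnitRealization_iff_no_conflict {V : Type u} [Fintype V] {k : ℕ}
    (G : Fin k → GraphOn V) (S : GraphOn V) (hsun : IsSunflower G S)
    (hrep : HasSimProperRep G)
    (ζ : ∀ i, StraightEnum (G i)) (hζ : IsSimEnum G S ζ) :
    (∃ I : V → ℝ × ℝ, (∀ i, (G i).IsUnitRep I) ∧ ∀ i, Realizes (G i) I (ζ i)) ↔
      ¬ HasConflict G S ζ := by
  constructor
  · rintro ⟨I, hI, hR⟩
    exact not_hasConflict_of_realizes hI hR
  · exact exists_realization_of_not_hasConflict hsun hζ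
end

section
/- A sunflower graph 𝒢 with simultaneous enumeration ζ has no conflict for ζ if and only if there exists a left-closed partial order τ on V(𝒢) that extends the partial order α on V(𝒢) induced by ζ. -/
/-!
Common definitions: graphs on a vertex subset, (proper/unit) interval
representations, blocks, straight enumerations, sunflower graphs,
simultaneous enumerations, components, chains/bars, etc.
-/

universe u

open GraphOn

variable {V : Type u}

/-- `Concat f n u v`: a nonempty concatenation of `f`-pieces leading from `u` to `v`,
of total size `n`. -/
inductive Concat (f : ℕ → V → V → Prop) : ℕ → V → V → Prop
  | single {n u v} : f n u v → Concat f n u v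
  | cons {m n u w v} : f m u w → Concat f n w v → Concat f (m + n) u v

theorem Concat.append {f : ℕ → V → V → Prop} {m n : ℕ} {u w v : V}
    (h : Concat f m u w) (h' : Concat f n w v) : Concat f (m + n) u v := by
  induction h with
  | single h => exact .cons h h'
  | cons h _ ih => rw [Nat.add_assoc]; exact .cons h (ih h')

/-- An abstract system of bars `f` and chains `d` (with their sizes) on a linearly ordered
set: splitting a bar or a chain at an intermediate point costs at most one, and a bar is always
shorter than a chain with the same ends. -/
structure ChainBarSystem (s : Set V) (le : V → V → Prop) (f d : ℕ → V → V → Prop) : Prop where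
  lin : IsLinOrdOn s le
  bar_mem : ∀ {n u v}, f n u v → u ∈ s ∧ v ∈ s ∧ le u v
  chain_mem : ∀ {n u v}, d n u v → u ∈ s ∧ v ∈ s ∧ le u v
  chain_pos : ∀ {n u v}, d n u v → 1 ≤ n
  bar_split : ∀ {n u v w}, f n u v → w ∈ s → le u w → le w v →
    ∃ a b, f a u w ∧ f b w v ∧ n ≤ a + b + 1
  chain_split : ∀ {n u v w}, d n u v → w ∈ s → le u w → le w v →
    ∃ a b, d a u w ∧ d b w v ∧ a + b ≤ n + 1
  bar_lt_chain : ∀ {m n u v}, f m u v → d n u v → m < n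

namespace Concat

variable {s : Set V} {le : V → V → Prop} {f d : ℕ → V → V → Prop}

theorem mem (lin : IsLinOrdOn s le)
    (hf : ∀ {n u v}, f n u v → u ∈ s ∧ v ∈ s ∧ le u v) {n : ℕ} {u v : V}
    (h : Concat f n u v) : u ∈ s ∧ v ∈ s ∧ le u v := by
  induction h with
  | single h => exact hf h
  | cons h _ ih =>
    obtain ⟨h1, h2, h3⟩ := hf h
    exact ⟨h1, ih.2.1, lin.2.1 _ h1 _ h2 _ ih.2.1 h3 ih.2.2⟩

theorem bar_split (H : ChainBarSystem s le f d) {n : ℕ} {u v w : V} (h : Concat f n u v)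
    (hw : w ∈ s) (huw : le u w) (hwv : le w v) :
    ∃ a b, Concat f a u w ∧ Concat f b w v ∧ n ≤ a + b + 1 := by
  induction h with
  | single h =>
    obtain ⟨a, b, ha, hb, hab⟩ := H.bar_split h hw huw hwv
    exact ⟨a, b, .single ha, .single hb, hab⟩
  | @cons m n u x v h h' ih =>
    rcases H.lin.2.2.2 w hw x (H.bar_mem h).2.1 with hwx | hxw
    · obtain ⟨a, b, ha, hb, hab⟩ := H.bar_split h hw huw hwx
      exact ⟨a, b + n, .single ha, .cons hb h', by omega⟩
    · obtain ⟨a, b, ha, hb, hab⟩ := ih hxw hwv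
      exact ⟨m + a, b, .cons h ha, hb, by omega⟩

theorem chain_split (H : ChainBarSystem s le f d) {n : ℕ} {u v w : V} (h : Concat d n u v)
    (hw : w ∈ s) (huw : le u w) (hwv : le w v) :
    ∃ a b, Concat d a u w ∧ Concat d b w v ∧ a + b ≤ n + 1 := by
  induction h with
  | single h =>
    obtain ⟨a, b, ha, hb, hab⟩ := H.chain_split h hw huw hwv
    exact ⟨a, b, .single ha, .single hb, hab⟩
  | @cons m n u x v h h' ih =>
    rcases H.lin.2.2.2 w hw x (H.chain_mem h).2.1 with hwx | hxw
    · obtain ⟨a, b, ha, hb, hab⟩ := H.chain_split h hw huw hwx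
      exact ⟨a, b + n, .single ha, .cons hb h', by omega⟩
    · obtain ⟨a, b, ha, hb, hab⟩ := ih hxw hwv
      exact ⟨m + a, b, .cons h ha, hb, by omega⟩

theorem bar_lt_concat (H : ChainBarSystem s le f d) {m n : ℕ} {u v : V} (h : f m u v)
    (h' : Concat d n u v) : m < n := by
  induction h' generalizing m with
  | single h' => exact H.bar_lt_chain h h'
  | cons hd hd' ih =>
    obtain ⟨a, b, ha, hb, hab⟩ := H.bar_split h (H.chain_mem hd).2.1 (H.chain_mem hd).2.2
      (hd'.mem H.lin H.chain_mem).2.2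
    have h1 := H.bar_lt_chain ha hd
    have h2 := ih hb
    omega

end Concat

namespace ChainBarSystem

variable {s : Set V} {le : V → V → Prop} {f d : ℕ → V → V → Prop}

theorem concat (H : ChainBarSystem s le f d) :
    ChainBarSystem s le (Concat f) (Concat d) where
  lin := H.lin
  bar_mem := Concat.mem H.lin H.bar_mem
  chain_mem := Concat.mem H.lin H.chain_mem
  chain_pos h := by
    induction h with
    | single h => exact H.chain_pos h
    | cons _ _ ih => omega
  bar_split := Concat.bar_split H
  chain_split := Concat.chain_split H
  bar_lt_chain h h' := by
    induction h generalizing ‹ℕ› with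
    | single h => exact Concat.bar_lt_concat H h h'
    | cons hf hf' ih =>
      obtain ⟨a, b, ha, hb, hab⟩ := Concat.chain_split H h' (H.bar_mem hf).2.1 (H.bar_mem hf).2.2
        (hf'.mem H.lin H.bar_mem).2.2
      have h1 := Concat.bar_lt_concat H hf ha
      have h2 := ih hb
      omega

end ChainBarSystem

/-- `Shift f d x y n`: the bars `f` and chains `d` force `y` to lie more than `n` units to the
right of `x` in every unit interval representation. -/
def Shift (f d : ℕ → V → V → Prop) (x y : V) (n : ℤ) : Prop :=
  (x ≠ y ∧ ∃ m : ℕ, n ≤ m ∧ f m x y) ∨ ∃ m : ℕ, n ≤ -m ∧ d m y x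

namespace ChainBarSystem

variable {s : Set V} {le : V → V → Prop} {f d : ℕ → V → V → Prop}

theorem shift_mem (H : ChainBarSystem s le f d) {x y : V} {n : ℤ} (h : Shift f d x y n) :
    x ∈ s ∧ y ∈ s := by
  rcases h with ⟨_, m, _, h⟩ | ⟨m, _, h⟩
  · exact ⟨(H.bar_mem h).1, (H.bar_mem h).2.1⟩
  · exact ⟨(H.chain_mem h).2.1, (H.chain_mem h).1⟩

theorem shift_self (H : ChainBarSystem s le f d) {x : V} {n : ℤ} (h : Shift f d x x n) :
    n < 0 := by
  rcases h with ⟨h, _⟩ | ⟨m, hm, h⟩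
  · exact absurd rfl h
  · have := H.chain_pos h
    omega

theorem shift_trans (H : ChainBarSystem s le f d) {x y z : V} {m n : ℤ}
    (h : Shift (Concat f) (Concat d) x y m) (h' : Shift (Concat f) (Concat d) y z n) :
    Shift (Concat f) (Concat d) x z (m + n) := by
  have C := H.concat
  rcases h with ⟨hne, p, hp, h⟩ | ⟨p, hp, h⟩ <;> rcases h' with ⟨hne', q, hq, h'⟩ | ⟨q, hq, h'⟩
  · refine .inl ⟨?_, p + q, by push_cast; omega, h.append h'⟩
    rintro rfl
    exact hne (C.lin.2.2.1 _ (C.bar_mem h).1 _ (C.bar_mem h).2.1 (C.bar_mem h).2.2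
      (C.bar_mem h').2.2)
  · obtain ⟨hx, hy, hxy⟩ := C.bar_mem h
    obtain ⟨hz, _, hzy⟩ := C.chain_mem h'
    by_cases hzx : le z x
    · obtain ⟨a, b, ha, hb, hab⟩ := C.chain_split h' hx hzx hxy
      have := C.bar_lt_chain h hb
      exact .inr ⟨a, by omega, ha⟩
    · have hxz := (C.lin.2.2.2 x hx z hz).resolve_right hzx
      obtain ⟨a, b, ha, hb, hab⟩ := C.bar_split h hz hxz hzy
      have := C.bar_lt_chain hb h'
      exact .inl ⟨by rintro rfl; exact hzx hxz, a, by omega, ha⟩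
  · obtain ⟨hy, hx, hyx⟩ := C.chain_mem h
    obtain ⟨_, hz, hyz⟩ := C.bar_mem h'
    by_cases hzx : le z x
    · obtain ⟨a, b, ha, hb, hab⟩ := C.chain_split h hz hyz hzx
      have := C.bar_lt_chain h' ha
      exact .inr ⟨b, by omega, hb⟩
    · have hxz := (C.lin.2.2.2 x hx z hz).resolve_right hzx
      obtain ⟨a, b, ha, hb, hab⟩ := C.bar_split h' hx hyx hxz
      have := C.bar_lt_chain ha h
      exact .inl ⟨by rintro rfl; exact hzx hxz, b, by omega, hb⟩
  · exact .inr ⟨q + p, by push_cast; omega, h'.append h⟩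

end ChainBarSystem

/-- Nonempty walks along the relations `A i`, with additive weights. -/
inductive WeightedWalk {ι : Type*} (A : ι → V → V → ℤ → Prop) : V → V → ℤ → Prop
  | single {i x y n} : A i x y n → WeightedWalk A x y n
  | tail {i x y z m n} : WeightedWalk A x y m → A i y z n → WeightedWalk A x z (m + n)

namespace WeightedWalk

variable {ι : Type*} {A : ι → V → V → ℤ → Prop}

theorem append {x y z : V} {m n : ℤ} (h : WeightedWalk A x y m) (h' : WeightedWalk A y z n) :
    WeightedWalk A x z (m + n) := by
  induction h' with
  | single h' => exact .tail h h'
  | tail _ h' ih => rw [← add_assoc]; exact .tail (ih h) h'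

/-- In a sunflower-like family of weighted relations whose pairwise intersections lie in `s`,
closed walks have negative weight as soon as this holds for each `A i` and for a transitive
relation `B` on `s` containing the restrictions of all `A i`. -/
theorem self_neg {t : ι → Set V} {s : Set V} {B : V → V → ℤ → Prop}
    (hst : ∀ i j, i ≠ j → t i ∩ t j ⊆ s)
    (Amem : ∀ {i x y n}, A i x y n → x ∈ t i ∧ y ∈ t i)
    (Atrans : ∀ {i x y z m n}, A i x y m → A i y z n → A i x z (m + n))
    (Aself : ∀ {i x n}, A i x x n → n < 0)
    (AB : ∀ {i x y n}, A i x y n → x ∈ s → y ∈ s → B x y n)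
    (Btrans : ∀ {x y z m n}, B x y m → B y z n → B x z (m + n))
    (Bself : ∀ {x n}, B x x n → n < 0) {x : V} {n : ℤ} (h : WeightedWalk A x x n) : n < 0 := by
  have key : ∀ {x y n}, WeightedWalk A x y n → (∃ i, A i x y n) ∨
      ∃ u ∈ s, ∃ v ∈ s, ∃ i j a b c, A i x u a ∧ (B u v b ∨ u = v ∧ b = 0) ∧ A j v y c ∧
        n = a + b + c := by
    intro x y n h
    induction h with
    | single h => exact .inl ⟨_, h⟩
    | @tail i x y z m n _ h ih =>
      rcases ih with ⟨j, h'⟩ | ⟨u, hu, v, hv, j, l, a, b, c, h1, h2, h3, rfl⟩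
      · by_cases hij : i = j
        · subst hij; exact .inl ⟨i, Atrans h' h⟩
        · have hy := hst i j hij ⟨(Amem h).1, (Amem h').2⟩
          exact .inr ⟨y, hy, y, hy, j, i, m, 0, n, h', .inr ⟨rfl, rfl⟩, h, by ring⟩
      · by_cases hil : i = l
        · subst hil
          exact .inr ⟨u, hu, v, hv, j, i, a, b, c + n, h1, h2, Atrans h3 h, by ring⟩
        · have hy := hst i l hil ⟨(Amem h).1, (Amem h3).2⟩
          refine .inr ⟨u, hu, y, hy, j, i, a, b + c, n, h1, .inl ?_, h, by ring⟩
          rcases h2 with h2 | ⟨rfl, rfl⟩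
          · exact Btrans h2 (AB h3 hv hy)
          · rw [zero_add]; exact AB h3 hv hy
  rcases key h with ⟨i, h⟩ | ⟨u, hu, v, hv, i, j, a, b, c, h1, h2, h3, rfl⟩
  · exact Aself h
  · have h4 : B v u (c + a) := by
      by_cases hij : i = j
      · subst hij; exact AB (Atrans h3 h1) hv hu
      · have hx := hst i j hij ⟨(Amem h1).1, (Amem h3).2⟩
        exact Btrans (AB h3 hv hx) (AB h1 hx hu)
    rcases h2 with h2 | ⟨rfl, rfl⟩
    · have := Bself (Btrans h2 h4)
      omega
    · have := Bself h4
      omega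

end WeightedWalk

/-- A sequence of `l` consecutive `R`-steps from `u` to `v`. -/
def StepSeq (R : V → V → Prop) (l : ℕ) (u v : V) : Prop :=
  ∃ c : ℕ → V, c 0 = u ∧ c l = v ∧ ∀ t < l, R (c t) (c (t + 1))

namespace StepSeq

variable {R : V → V → Prop}

theorem zero (u : V) : StepSeq R 0 u u := ⟨fun _ => u, rfl, rfl, by simp⟩

theorem cons {l : ℕ} {u w v : V} (h : R u w) (h' : StepSeq R l w v) : StepSeq R (l + 1) u v := by
  obtain ⟨c, rfl, rfl, hc⟩ := h'
  refine ⟨fun t => Nat.casesOn t u c, rfl, rfl, ?_⟩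
  rintro (_ | t) ht
  · exact h
  · exact hc t (by omega)

theorem uncons {l : ℕ} {u v : V} (h : StepSeq R (l + 1) u v) : ∃ w, R u w ∧ StepSeq R l w v := by
  obtain ⟨c, rfl, rfl, hc⟩ := h
  exact ⟨c 1, hc 0 (by omega), fun t => c (t + 1), rfl, rfl, fun t ht => hc (t + 1) (by omega)⟩

end StepSeq

namespace StraightEnum

variable {G : GraphOn V} (σ : StraightEnum G)

/-- Elementary bars: comparable pairs (size `0`) and ordered non-edges (size `1`). -/
def BarStep (n : ℕ) (u v : V) : Prop :=
  u ∈ G.verts ∧ v ∈ G.verts ∧ σ.le u v ∧ (n = 0 ∨ n = 1 ∧ u ≠ v ∧ ¬ G.Adj u v)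

/-- Elementary chains: ordered pairs of adjacent or equal vertices. -/
def ChainStep (n : ℕ) (u v : V) : Prop :=
  u ∈ G.verts ∧ v ∈ G.verts ∧ σ.le u v ∧ n = 1 ∧ (G.Adj u v ∨ u = v)

/-- No two vertices of `G` lie in a common block. -/
def BlocksTrivial : Prop := ∀ u ∈ G.verts, ∀ v ∈ G.verts, σ.le u v → σ.le v u → u = v

variable {σ}

theorem BlocksTrivial.isLinOrdOn (hd : σ.BlocksTrivial) : IsLinOrdOn G.verts σ.le := ⟨σ.refl, σ.trans, hd, σ.total⟩

theorem BlocksTrivial.lt_of_le_of_ne (hd : σ.BlocksTrivial) {u v : V} (hu : u ∈ G.verts) (hv : v ∈ G.verts)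
    (h : σ.le u v) (hne : u ≠ v) : σ.lt u v := ⟨h, fun h' => hne (hd u hu v hv h h')⟩

theorem BlocksTrivial.cAdj_iff (hd : σ.BlocksTrivial) {u v : V} (hu : u ∈ G.verts) (hv : v ∈ G.verts) :
    G.CAdj u v ↔ G.Adj u v ∨ u = v := by
  refine or_congr_right ⟨fun h => ?_, ?_⟩
  · obtain ⟨h1, h2⟩ := (σ.eq_block u hu v hv).2 h
    exact hd u hu v hv h1 h2
  · rintro rfl
    exact ⟨hu, hu, fun _ => Iff.rfl⟩

theorem BlocksTrivial.straight (hd : σ.BlocksTrivial) {u v w : V} (hu : u ∈ G.verts) (hv : v ∈ G.verts)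
    (hw : w ∈ G.verts) (huv : σ.le u v) (hvw : σ.le v w) (h : G.Adj u w ∨ u = w) :
    (G.Adj u v ∨ u = v) ∧ (G.Adj v w ∨ v = w) := by
  have := σ.straight u hu v hv w hw huv hvw ((hd.cAdj_iff hu hw).2 h)
  rwa [hd.cAdj_iff hu hv, hd.cAdj_iff hv hw] at this

theorem BlocksTrivial.chainBarSystem (hd : σ.BlocksTrivial) :
    ChainBarSystem G.verts σ.le σ.BarStep σ.ChainStep where
  lin := hd.isLinOrdOn
  bar_mem h := ⟨h.1, h.2.1, h.2.2.1⟩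
  chain_mem h := ⟨h.1, h.2.1, h.2.2.1⟩
  chain_pos h := h.2.2.2.1.ge
  bar_split := by
    rintro n u v w ⟨hu, hv, _, h⟩ hw huw hwv
    exact ⟨0, 0, ⟨hu, hw, huw, .inl rfl⟩, ⟨hw, hv, hwv, .inl rfl⟩, by omega⟩
  chain_split := by
    rintro n u v w ⟨hu, hv, _, rfl, h⟩ hw huw hwv
    obtain ⟨h1, h2⟩ := hd.straight hu hw hv huw hwv h
    exact ⟨1, 1, ⟨hu, hw, huw, rfl, h1⟩, ⟨hw, hv, hwv, rfl, h2⟩, le_rfl⟩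
  bar_lt_chain := by
    rintro m n u v ⟨_, _, _, rfl | ⟨rfl, hne, hadj⟩⟩ ⟨_, _, _, rfl, h⟩
    · exact zero_lt_one
    · exact absurd h (not_or.2 ⟨hadj, hne⟩)

theorem lt_of_steps {c : ℕ → V} {l : ℕ} (hmem : ∀ t ≤ l, c t ∈ G.verts)
    (hc : ∀ t < l, σ.lt (c t) (c (t + 1))) {s t : ℕ} (hst : s < t) (ht : t ≤ l) :
    σ.lt (c s) (c t) := by
  induction t, hst using Nat.le_induction with
  | base => exact hc s ht
  | succ t hst ih =>
    have h1 := ih (by omega)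
    have h2 := hc t (by omega)
    have ms := hmem s (by omega)
    have mt := hmem t (by omega)
    have mt' := hmem (t + 1) ht
    exact ⟨σ.trans _ ms _ mt _ mt' h1.1 h2.1, fun h => h1.2 (σ.trans _ mt _ mt' _ ms h2.1 h)⟩

theorem stepSeq_mem {R : V → V → Prop} (hR : ∀ {u v}, R u v → u ∈ G.verts ∧ v ∈ G.verts)
    {c : ℕ → V} {l : ℕ} (hl : 1 ≤ l) (hc : ∀ t < l, R (c t) (c (t + 1))) :
    ∀ t ≤ l, c t ∈ G.verts := by
  rintro (_ | t) ht
  · exact (hR (hc 0 (by omega))).1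
  · exact (hR (hc t (by omega))).2

theorem BlocksTrivial.bar_extend (hd : σ.BlocksTrivial) {u u' v v' : V}
    (hu : u ∈ G.verts) (hv : v ∈ G.verts) (huu' : σ.le u u') (hvv' : σ.le v' v)
    (h : u' ≠ v' ∧ σ.BarStep 1 u' v') : u ≠ v ∧ σ.BarStep 1 u v := by
  obtain ⟨hne, hu', hv', hle, h⟩ := h
  have h := (h.resolve_left one_ne_zero).2.2
  have hle' := σ.trans _ hu _ hu' _ hv' huu' hle
  have key : ¬ (G.Adj u v ∨ u = v) := fun h' =>
    not_or.2 ⟨h, hne⟩ (hd.straight hu hu' hv' huu' hle (hd.straight hu hv' hv hle' hvv' h').1).2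
  rw [not_or] at key
  exact ⟨key.2, hu, hv, σ.trans _ hu _ hv' _ hv hle' hvv', .inr ⟨rfl, key.2, key.1⟩⟩

theorem BlocksTrivial.bar_stepSeq (hd : σ.BlocksTrivial) {n : ℕ} {u v : V}
    (h : Concat σ.BarStep n u v) :
    n = 0 ∨ StepSeq (fun x y => x ≠ y ∧ σ.BarStep 1 x y) n u v := by
  induction h with
  | @single n u v h =>
    obtain ⟨hu, hv, huv, rfl | ⟨rfl, h⟩⟩ := h
    · exact .inl rfl
    · exact .inr (.cons ⟨h.1, hu, hv, huv, .inr ⟨rfl, h⟩⟩ (.zero v))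
  | @cons m n u w v h h' ih =>
    obtain ⟨hw, hv, hwv⟩ := h'.mem hd.isLinOrdOn hd.chainBarSystem.bar_mem
    obtain ⟨hu, _, huw, rfl | ⟨rfl, h⟩⟩ := h
    · rw [Nat.zero_add]
      cases n with
      | zero => exact .inl rfl
      | succ n =>
        obtain ⟨x, hx, hs⟩ := (ih.resolve_left n.succ_ne_zero).uncons
        exact .inr (.cons (hd.bar_extend hu hx.2.2.1 huw (σ.refl _ hx.2.2.1) hx) hs)
    · have hstep : u ≠ w ∧ σ.BarStep 1 u w := ⟨h.1, hu, hw, huw, .inr ⟨rfl, h⟩⟩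
      rw [Nat.add_comm]
      rcases ih with rfl | ih
      · exact .inr (.cons (hd.bar_extend hu hv (σ.refl _ hu) hwv hstep) (.zero v))
      · exact .inr (.cons hstep ih)

theorem BlocksTrivial.chain_stepSeq (hd : σ.BlocksTrivial) {n : ℕ} {u v : V} (h : Concat σ.ChainStep n u v) :
    ∃ l ≤ n, StepSeq (fun x y => σ.lt x y ∧ G.Adj x y) l u v := by
  have step : ∀ {n u w}, σ.ChainStep n u w → u ≠ w → σ.lt u w ∧ G.Adj u w := by
    rintro n u w ⟨hu, hw, huw, _, h⟩ hne
    exact ⟨hd.lt_of_le_of_ne hu hw huw hne, h.resolve_right hne⟩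
  induction h with
  | @single n u v h =>
    by_cases huv : u = v
    · subst huv; exact ⟨0, Nat.zero_le _, .zero u⟩
    · exact ⟨1, h.2.2.2.1.ge, .cons (step h huv) (.zero v)⟩
  | @cons m n u w v h _ ih =>
    obtain ⟨l, hl, hs⟩ := ih
    by_cases huw : u = w
    · subst huw; exact ⟨l, by omega, hs⟩
    · have := h.2.2.2.1
      exact ⟨l + 1, by omega, .cons (step h huw) hs⟩

theorem isChainSeq_of_stepSeq {l : ℕ} {u v : V} (hl : 1 ≤ l)
    (h : StepSeq (fun x y => σ.lt x y ∧ G.Adj x y) l u v) : IsChainSeq G σ u v (l + 1) := by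
  obtain ⟨c, hu, hv, hc⟩ := h
  have hmem := stepSeq_mem (R := fun x y => σ.lt x y ∧ G.Adj x y) (fun h => G.mem_of_adj h.2) hl hc
  exact ⟨c, hu, hv, fun t ht => hmem t (by omega),
    fun s t hst ht => lt_of_steps hmem (fun t ht => (hc t ht).1) hst (by omega),
    fun t ht => (hc t (by omega)).2⟩

theorem BlocksTrivial.isBarSeq (hd : σ.BlocksTrivial) {l : ℕ} {u v : V} (hl : 1 ≤ l)
    (h : StepSeq (fun x y => x ≠ y ∧ σ.BarStep 1 x y) l u v) : IsBarSeq G σ u v (l + 1) := by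
  obtain ⟨c, hu, hv, hc⟩ := h
  have hmem := stepSeq_mem (G := G) (R := fun x y => x ≠ y ∧ σ.BarStep 1 x y)
    (fun h => ⟨h.2.1, h.2.2.1⟩) hl hc
  have hlt : ∀ {s t}, s < t → t ≤ l → σ.lt (c s) (c t) := fun hst ht =>
    lt_of_steps hmem (fun t ht => hd.lt_of_le_of_ne (hc t ht).2.1 (hc t ht).2.2.1
      (hc t ht).2.2.2.1 (hc t ht).1) hst ht
  have hnadj : ∀ {s t}, s < t → t ≤ l → ¬ G.Adj (c s) (c t) := by
    intro s t hst ht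
    have hle : σ.le (c (s + 1)) (c t) := by
      rcases Nat.eq_or_lt_of_le (Nat.succ_le_of_lt hst) with rfl | h
      · exact σ.refl _ (hmem _ ht)
      · exact (hlt h ht).1
    have h := hd.bar_extend (hmem s (by omega)) (hmem t ht) (σ.refl _ (hmem s (by omega))) hle
      (hc s (by omega))
    exact (h.2.2.2.2.resolve_left one_ne_zero).2.2
  refine ⟨c, hu, hv, fun t ht => hmem t (by omega), fun s t hst ht => hlt hst (by omega),
    fun s t hs ht hst => ?_⟩
  rcases Nat.lt_or_gt_of_ne hst with h | h
  · exact hnadj h (by omega)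
  · exact fun h' => hnadj h (by omega) (G.symm h')

end StraightEnum

section Sunflower

variable {k : ℕ} {G : Fin k → GraphOn V} {S : GraphOn V} {ζ : ∀ i, StraightEnum (G i)}

theorem bar_lt_chain_of_not_hasConflict (hd : ∀ i, (ζ i).BlocksTrivial)
    (hSG : ∀ i, S.verts ⊆ (G i).verts) (hc : ¬ HasConflict G S ζ) {i j : Fin k} {u v : V}
    (hu : u ∈ S.verts) (hv : v ∈ S.verts) {m n : ℕ} (hm : Concat (ζ i).BarStep m u v)
    (hn : Concat (ζ j).ChainStep n u v) : m < n := by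
  have hn1 := (hd j).chainBarSystem.concat.chain_pos hn
  by_cases huv : u = v
  · subst huv
    have hu' := hSG i hu
    have h1 : (ζ i).ChainStep 1 u u := ⟨hu', hu', (ζ i).refl u hu', rfl, .inr rfl⟩
    exact ((hd i).chainBarSystem.concat.bar_lt_chain hm (.single h1)).trans_le hn1
  · by_contra! hnm
    obtain ⟨l, hln, hl⟩ := (hd j).chain_stepSeq hn
    have hl1 : 1 ≤ l := by
      rcases Nat.eq_zero_or_pos l with rfl | h
      · obtain ⟨c, h0, h1, _⟩ := hl
        exact absurd (h0.symm.trans h1) huv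
      · exact h
    have hb := ((hd i).bar_stepSeq hm).resolve_left (by omega)
    exact hc ⟨u, hu, v, hv, huv, j, i, l + 1, by omega, StraightEnum.isChainSeq_of_stepSeq hl1 hl, m + 1,
      by omega, (hd i).isBarSeq (by omega) hb⟩

theorem IsSimEnum.le_of_le (hζ : IsSimEnum G S ζ) (hd : ∀ i, (ζ i).BlocksTrivial)
    (hSG : ∀ i, S.verts ⊆ (G i).verts) {i j : Fin k} {u v : V}
    (hu : u ∈ S.verts) (hv : v ∈ S.verts) (h : (ζ i).le u v) : (ζ j).le u v := by
  by_cases huv : u = v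
  · subst huv; exact (ζ j).refl u (hSG j hu)
  · exact hζ i j u hu v hv ((hd i).lt_of_le_of_ne (hSG i hu) (hSG i hv) h huv)

/-- Pieces between shared vertices, each lying in one of the graphs. -/
def SharedStep (S : GraphOn V) (f : Fin k → ℕ → V → V → Prop) (n : ℕ) (u v : V) : Prop :=
  u ∈ S.verts ∧ v ∈ S.verts ∧ ∃ i, f i n u v

theorem chainBarSystem_shared (hζ : IsSimEnum G S ζ) (hd : ∀ i, (ζ i).BlocksTrivial)
    (hSG : ∀ i, S.verts ⊆ (G i).verts) (hc : ¬ HasConflict G S ζ) (i₀ : Fin k) :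
    ChainBarSystem S.verts (ζ i₀).le (SharedStep S fun i => Concat (ζ i).BarStep)
      (SharedStep S fun i => Concat (ζ i).ChainStep) where
  lin := by
    obtain ⟨h1, h2, h3, h4⟩ := (hd i₀).isLinOrdOn
    have h := @(hSG i₀)
    exact ⟨fun v hv => h1 v (h hv), fun u hu v hv w hw => h2 u (h hu) v (h hv) w (h hw),
      fun u hu v hv => h3 u (h hu) v (h hv), fun u hu v hv => h4 u (h hu) v (h hv)⟩
  bar_mem := by
    rintro n u v ⟨hu, hv, i, h⟩
    exact ⟨hu, hv, hζ.le_of_le hd hSG hu hv ((hd i).chainBarSystem.concat.bar_mem h).2.2⟩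
  chain_mem := by
    rintro n u v ⟨hu, hv, i, h⟩
    exact ⟨hu, hv, hζ.le_of_le hd hSG hu hv ((hd i).chainBarSystem.concat.chain_mem h).2.2⟩
  chain_pos := by
    rintro n u v ⟨_, _, i, h⟩
    exact (hd i).chainBarSystem.concat.chain_pos h
  bar_split := by
    rintro n u v w ⟨hu, hv, i, h⟩ hw huw hwv
    obtain ⟨a, b, ha, hb, hab⟩ := (hd i).chainBarSystem.concat.bar_split h (hSG i hw)
      (hζ.le_of_le hd hSG hu hw huw) (hζ.le_of_le hd hSG hw hv hwv)
    exact ⟨a, b, ⟨hu, hw, i, ha⟩, ⟨hw, hv, i, hb⟩, hab⟩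
  chain_split := by
    rintro n u v w ⟨hu, hv, i, h⟩ hw huw hwv
    obtain ⟨a, b, ha, hb, hab⟩ := (hd i).chainBarSystem.concat.chain_split h (hSG i hw)
      (hζ.le_of_le hd hSG hu hw huw) (hζ.le_of_le hd hSG hw hv hwv)
    exact ⟨a, b, ⟨hu, hw, i, ha⟩, ⟨hw, hv, i, hb⟩, hab⟩
  bar_lt_chain := by
    rintro m n u v ⟨hu, hv, i, h⟩ ⟨_, _, j, h'⟩
    exact bar_lt_chain_of_not_hasConflict hd hSG hc hu hv h h'

/-- The shifts forced in the sunflower graph by bars and chains of the single graphs. -/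
def SunflowerShift (G : Fin k → GraphOn V) (ζ : ∀ i, StraightEnum (G i)) :
    V → V → ℤ → Prop :=
  WeightedWalk fun i => Shift (Concat (ζ i).BarStep) (Concat (ζ i).ChainStep)

theorem SunflowerShift.append {x y z : V} {m n : ℤ} (h : SunflowerShift G ζ x y m)
    (h' : SunflowerShift G ζ y z n) : SunflowerShift G ζ x z (m + n) :=
  WeightedWalk.append h h'

theorem sunflowerShift_self_neg (hsun : IsSunflower G S) (hζ : IsSimEnum G S ζ)
    (hd : ∀ i, (ζ i).BlocksTrivial) (hc : ¬ HasConflict G S ζ) {x : V} {n : ℤ}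
    (h : SunflowerShift G ζ x x n) : n < 0 := by
  have hSG : ∀ i, S.verts ⊆ (G i).verts := fun i => (hsun.1 i).1
  obtain ⟨i₀⟩ : Nonempty (Fin k) := by
    cases h with
    | @single i => exact ⟨i⟩
    | @tail i => exact ⟨i⟩
  have H := chainBarSystem_shared hζ hd hSG hc i₀
  refine WeightedWalk.self_neg (t := fun i => (G i).verts) (s := S.verts)
    (B := Shift (Concat (SharedStep S fun i => Concat (ζ i).BarStep))
      (Concat (SharedStep S fun i => Concat (ζ i).ChainStep)))
    (fun i j hij => (hsun.2 i j hij).1.subset)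
    (fun {i _ _ _} => (hd i).chainBarSystem.concat.shift_mem)
    (fun {i _ _ _ _ _} => (hd i).chainBarSystem.shift_trans)
    (fun {i _ _} => (hd i).chainBarSystem.concat.shift_self)
    ?_ H.shift_trans H.concat.shift_self h
  rintro i x y n (⟨hne, m, hm, h⟩ | ⟨m, hm, h⟩) hx hy
  · exact .inl ⟨hne, m, hm, .single ⟨hx, hy, i, h⟩⟩
  · exact .inr ⟨m, hm, .single ⟨hy, hx, i, h⟩⟩

theorem sunflowerShift_of_le {i : Fin k} {u v : V} (hu : u ∈ (G i).verts) (hv : v ∈ (G i).verts)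
    (h : (ζ i).le u v) (hne : u ≠ v) : SunflowerShift G ζ u v 0 :=
  .single (i := i) (.inl ⟨hne, 0, le_rfl, .single ⟨hu, hv, h, .inl rfl⟩⟩)

theorem eq_or_sunflowerShift_of_alphaOrd {u v : V} (h : alphaOrd G ζ u v) :
    u = v ∨ SunflowerShift G ζ u v 0 := by
  have step : ∀ {u v}, alphaStar G ζ u v → u = v ∨ SunflowerShift G ζ u v 0 := by
    rintro u v ⟨i, hu, hv, h⟩
    exact or_iff_not_imp_left.2 (sunflowerShift_of_le hu hv h)
  induction h with
  | single h => exact step h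
  | tail _ h ih =>
    rcases ih with rfl | ih
    · exact step h
    · rcases step h with rfl | h
      · exact .inr ih
      · exact .inr (by simpa using ih.append h)

theorem le_of_alphaOrd (hself : ∀ x, ¬ SunflowerShift G ζ x x 0) {u v : V}
    (h : alphaOrd G ζ u v) (hne : u ≠ v) {i : Fin k} (hu : u ∈ (G i).verts)
    (hv : v ∈ (G i).verts) : (ζ i).le u v := by
  refine ((ζ i).total u hu v hv).resolve_right fun h' => hself u ?_
  have h1 := (eq_or_sunflowerShift_of_alphaOrd h).resolve_left hne
  simpa using h1.append (sunflowerShift_of_le hv hu h' hne.symm)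

theorem exists_leftClosed_partialOrder (hself : ∀ {x n}, SunflowerShift G ζ x x n → n < 0) :
    ∃ τ : V → V → Prop, IsPartialOrderOn (⋃ i, (G i).verts) τ ∧
      (∀ u v, alphaOrd G ζ u v → τ u v) ∧ LeftClosed G ζ τ := by
  have hself' : ∀ x, ¬ SunflowerShift G ζ x x 0 := fun x h => (hself h).false
  refine ⟨fun u v => u = v ∨ ∃ n ≥ 0, SunflowerShift G ζ u v n,
    ⟨fun _ _ => .inl rfl, ?_, ?_⟩, ?_, ?_⟩
  · rintro u - v - w - (rfl | ⟨m, hm, h⟩) (rfl | ⟨n, hn, h'⟩)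
    · exact .inl rfl
    · exact .inr ⟨n, hn, h'⟩
    · exact .inr ⟨m, hm, h⟩
    · exact .inr ⟨m + n, by omega, h.append h'⟩
  · rintro u - v - (rfl | ⟨m, hm, h⟩) (h' | ⟨n, hn, h'⟩)
    · rfl
    · rfl
    · exact h'.symm
    · have := hself (h.append h')
      omega
  · exact fun u v h => (eq_or_sunflowerShift_of_alphaOrd h).imp_right fun h => ⟨0, le_rfl, h⟩
  · rintro v w u x ⟨hvw, i, hadj⟩ ⟨hux, hne, j, hu, hx, hnadj⟩ hxw
    obtain ⟨hv, hw⟩ := (G i).mem_of_adj hadj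
    have hvw' : v ≠ w := by rintro rfl; exact (G i).loopless v hadj
    have h1 : SunflowerShift G ζ u x 1 := .single (i := j) (.inl ⟨hne, 1, by simp,
      .single ⟨hu, hx, le_of_alphaOrd hself' hux hne hu hx, .inr ⟨rfl, hne, hnadj⟩⟩⟩)
    have h2 : SunflowerShift G ζ w v (-1) := .single (i := i) (.inr ⟨1, by simp,
      .single ⟨hv, hw, le_of_alphaOrd hself' hvw hvw' hv hw, rfl, .inl hadj⟩⟩)
    obtain ⟨n, hn, h⟩ : ∃ n ≥ 0, SunflowerShift G ζ u v n := by
      rcases hxw with rfl | ⟨n, hn, h⟩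
      · exact ⟨_, by norm_num, h1.append h2⟩
      · exact ⟨_, by omega, (h1.append h).append h2⟩
    refine ⟨.inr ⟨n, hn, h⟩, ?_⟩
    rintro rfl
    exact absurd (hself h) (by omega)

theorem not_hasConflict_of_leftClosed (hSG : ∀ i, S.verts ⊆ (G i).verts) {τ : V → V → Prop}
    (hτ : IsPartialOrderOn (⋃ i, (G i).verts) τ) (hα : ∀ u v, alphaOrd G ζ u v → τ u v)
    (hlc : LeftClosed G ζ τ) : ¬ HasConflict G S ζ := by
  rintro ⟨u, hu, v, hv, -, i, j, l, hl, ⟨c, c0, cl, cmem, clt, cadj⟩, m, hlm,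
    ⟨b, b0, bm, bmem, blt, bnadj⟩⟩
  have union_mem : ∀ {i x}, x ∈ (G i).verts → x ∈ ⋃ i, (G i).verts :=
    fun h => Set.mem_iUnion.2 ⟨_, h⟩
  have key : ∀ t < l, τ (b (m - 1 - t)) (c (l - 1 - t)) ∧
      (1 ≤ t → b (m - 1 - t) ≠ c (l - 1 - t)) := by
    intro t
    induction t with
    | zero =>
      intro _
      simp only [Nat.sub_zero, bm, cl]
      exact ⟨hτ.1 v (union_mem (hSG i hv)), by omega⟩
    | succ t ih =>
      intro ht
      have hs : l - 1 - t = l - 1 - (t + 1) + 1 := by omega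
      have hE : ERel G ζ (c (l - 1 - (t + 1))) (c (l - 1 - t)) := by
        refine ⟨.single ⟨i, cmem _ (by omega), cmem _ (by omega),
          (clt _ _ (by omega) (by omega)).1⟩, i, ?_⟩
        rw [hs]
        exact cadj _ (by omega)
      have hblt := blt (m - 1 - (t + 1)) (m - 1 - t) (by omega) (by omega)
      have hF : FRel G ζ (b (m - 1 - (t + 1))) (b (m - 1 - t)) := by
        refine ⟨.single ⟨j, bmem _ (by omega), bmem _ (by omega), hblt.1⟩, fun h => ?_, j,
          bmem _ (by omega), bmem _ (by omega), bnadj _ _ (by omega) (by omega) (by omega)⟩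
        rw [h] at hblt
        exact hblt.2 hblt.1
      obtain ⟨h1, h2⟩ := hlc _ _ _ _ hE hF (ih (by omega)).1
      exact ⟨h1, fun _ => h2⟩
  obtain ⟨h1, h2⟩ := key (l - 1) (by omega)
  have h2 := h2 (by omega)
  rw [Nat.sub_self, c0] at h1 h2
  have hb := bmem (m - 1 - (l - 1)) (by omega)
  have hle : (ζ j).le u (b (m - 1 - (l - 1))) := by
    rcases Nat.eq_zero_or_pos (m - 1 - (l - 1)) with h | h
    · rw [h, b0]
      exact (ζ j).refl u (hSG j hu)
    · have := (blt 0 _ h (by omega)).1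
      rwa [b0] at this
  exact h2 (hτ.2.2 _ (union_mem hb) _ (union_mem (hSG j hu)) h1
    (hα _ _ (.single ⟨j, hSG j hu, hb, hle⟩)))

end Sunflower

/-- A sunflower graph with simultaneous enumeration `ζ` (with
indistinguishable vertices identified, so each `ζ_i` is a linear order on `V_i`)
has no conflict for `ζ` iff there is a left-closed partial order on `V(𝒢)` extending
the partial order `α` induced by `ζ`. -/
theorem no_conflict_iff_leftClosed_partialOrder {V : Type u} [Fintype V] {k : ℕ}
    (G : Fin k → GraphOn V) (S : GraphOn V) (hsun : IsSunflower G S)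
    (ζ : ∀ i, StraightEnum (G i)) (hζ : IsSimEnum G S ζ)
    (hdist : ∀ i, ∀ u ∈ (G i).verts, ∀ v ∈ (G i).verts,
      (ζ i).le u v → (ζ i).le v u → u = v) :
    ¬ HasConflict G S ζ ↔
      ∃ τ : V → V → Prop, IsPartialOrderOn (⋃ i, (G i).verts) τ ∧
        (∀ u v, alphaOrd G ζ u v → τ u v) ∧ LeftClosed G ζ τ := by
  exact ⟨fun h => exists_leftClosed_partialOrder (sunflowerShift_self_neg hsun hζ hdist h),
    fun ⟨_, hτ, hα, hlc⟩ => not_hasConflict_of_leftClosed (fun i => (hsun.1 i).1) hτ hα hlc⟩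
end

section
/- Let 𝒢 be a sunflower graph with simultaneous enumeration ζ and let α be the partial order on V(𝒢) induced by ζ. Then there exists a left-closed linear order τ extending α if and only if there exists a left-closed partial order σ extending α. -/
/-!
Common definitions: graphs on a vertex subset, (proper/unit) interval
representations, blocks, straight enumerations, sunflower graphs,
simultaneous enumerations, components, chains/bars, etc.
-/

universe u

open GraphOn

variable {V : Type u}

theorem IsLinOrdOn.isPartialOrderOn {s : Set V} {le : V → V → Prop} (h : IsLinOrdOn s le) :
    IsPartialOrderOn s le :=
  ⟨h.1, h.2.1, h.2.2.1⟩

theorem IsPartialOrderOn.exists_minimal [Finite V] {s T : Set V} {σ : V → V → Prop}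
    (hσ : IsPartialOrderOn s σ) (hT : T ⊆ s) (hne : T.Nonempty) :
    ∃ m ∈ T, ∀ x ∈ T, σ x m → x = m := by
  obtain ⟨-, htrans, hanti⟩ := hσ
  let r : V → V → Prop := fun x y => x ∈ s ∧ y ∈ s ∧ σ x y ∧ x ≠ y
  have : IsTrans V r := ⟨fun x y z hxy hyz => ⟨hxy.1, hyz.2.1,
    htrans x hxy.1 y hxy.2.1 z hyz.2.1 hxy.2.2.1 hyz.2.2.1, by
      rintro rfl
      exact hxy.2.2.2 (hanti x hxy.1 y hxy.2.1 hxy.2.2.1 hyz.2.2.1)⟩⟩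
  have : Std.Irrefl r := ⟨fun x h => h.2.2.2 rfl⟩
  obtain ⟨m, hm, hmin⟩ := (Finite.wellFounded_of_trans_of_irrefl r).has_min T hne
  exact ⟨m, hm, fun x hx hxm => by_contra fun hne => hmin x hx ⟨hT hx, hT hm, hxm, hne⟩⟩

/-- The order `σ` with `a` placed below every vertex of `s` outside of `P`. -/
def placeNext (s P : Set V) (σ : V → V → Prop) (a : V) (x y : V) : Prop :=
  σ x y ∨ x = a ∧ y ∈ s \ P

section

variable {s P : Set V} {σ : V → V → Prop} {a : V}

theorem IsPartialOrderOn.placeNext (hσ : IsPartialOrderOn s σ)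
    (hlow : ∀ p ∈ P, ∀ q ∈ s \ P, σ p q)
    (hmin : ∀ x ∈ s \ P, σ x a → x = a) :
    IsPartialOrderOn s (placeNext s P σ a) := by
  obtain ⟨hrefl, htrans, hanti⟩ := hσ
  refine ⟨fun v hv => .inl (hrefl v hv), ?_, ?_⟩
  · rintro x hx y hy z hz (hxy | ⟨rfl, hyP⟩) (hyz | ⟨rfl, hzP⟩)
    · exact .inl (htrans x hx y hy z hz hxy hyz)
    · by_cases hxP : x ∈ P
      · exact .inl (hlow x hxP z hzP)
      · exact .inr ⟨hmin x ⟨hx, hxP⟩ hxy, hzP⟩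
    · refine .inr ⟨rfl, hz, fun hzP => hyP.2 ?_⟩
      exact hanti y hy z hz hyz (hlow z hzP y hyP) ▸ hzP
    · exact .inr ⟨rfl, hzP⟩
  · rintro x hx y hy (hxy | ⟨rfl, hyP⟩) (hyx | ⟨rfl, hxP⟩)
    · exact hanti x hx y hy hxy hyx
    · exact hmin x hxP hxy
    · exact (hmin y hyP hyx).symm
    · rfl

/-- Every left-closed partial order on a finite set in which an initial segment `P` is already
linearly ordered extends to a left-closed linear order. -/
theorem exists_leftClosed_linear_extension_of_initial [Finite V] {E F : V → V → Prop}
    (hE : ∀ v w, E v w → v ∈ s ∧ w ∈ s) (hF : ∀ u x, F u x → u ∈ s ∧ x ∈ s ∧ u ≠ x)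
    (hσ : IsPartialOrderOn s σ) (hFσ : ∀ u x, F u x → σ u x)
    (hclosed : ∀ v w u x, E v w → F u x → σ x w → σ u v ∧ u ≠ v)
    (hPs : P ⊆ s) (htot : ∀ x ∈ P, ∀ y ∈ P, σ x y ∨ σ y x)
    (hlow : ∀ p ∈ P, ∀ q ∈ s \ P, σ p q) :
    ∃ τ : V → V → Prop, IsLinOrdOn s τ ∧ (∀ u v, σ u v → τ u v) ∧
      ∀ v w u x, E v w → F u x → τ x w → τ u v ∧ u ≠ v := by
  induction hn : (s \ P).ncard generalizing P σ with
  | zero =>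
    have hsP : s ⊆ P := Set.sdiff_eq_empty.1 ((Set.ncard_eq_zero (Set.toFinite _)).1 hn)
    exact ⟨σ, ⟨hσ.1, hσ.2.1, hσ.2.2, fun x hx y hy => htot x (hsP hx) y (hsP hy)⟩,
      fun _ _ h => h, hclosed⟩
  | succ n ih =>
    obtain ⟨hrefl, htrans, hanti⟩ := id hσ
    obtain ⟨a, ha, hmin, hgood⟩ : ∃ a ∈ s \ P, (∀ x ∈ s \ P, σ x a → x = a) ∧
        ∀ v w u, E v w → F u a → v ∈ P → w ∉ P → u ∈ P → ¬ σ v u := by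
      by_cases hleave : ({v | v ∈ P ∧ ∃ w, w ∉ P ∧ E v w} : Set V).Nonempty
      · obtain ⟨v₀, ⟨hv₀, w₀, hw₀, hvw₀⟩, hv₀min⟩ :=
          hσ.exists_minimal (fun v hv => hPs hv.1) hleave
        have hw₀s := (hE _ _ hvw₀).2
        obtain ⟨a, ⟨haP, haw⟩, hamin⟩ :=
          hσ.exists_minimal (T := {x | x ∈ s \ P ∧ σ x w₀}) (fun x hx => hx.1.1)
            ⟨w₀, ⟨hw₀s, hw₀⟩, hrefl w₀ hw₀s⟩
        refine ⟨a, haP, fun x hx hxa =>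
          hamin x ⟨hx, htrans x hx.1 a haP.1 w₀ hw₀s hxa haw⟩ hxa, ?_⟩
        intro v w u hvw hua hv hw hu hvu
        obtain ⟨huv₀, hne⟩ := hclosed v₀ w₀ u a hvw₀ hua haw
        have hv₀v : σ v₀ v := by
          rcases htot v₀ hv₀ v hv with h | h
          · exact h
          · exact hv₀min v ⟨hv, w, hw, hvw⟩ h ▸ hrefl v (hPs hv)
        exact hne (hanti u (hPs hu) v₀ (hPs hv₀) huv₀
          (htrans v₀ (hPs hv₀) v (hPs hv) u (hPs hu) hv₀v hvu))
      · obtain ⟨a, ha, hamin⟩ := hσ.exists_minimal (T := s \ P) Set.sdiff_subset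
          (Set.nonempty_of_ncard_ne_zero (by omega))
        exact ⟨a, ha, hamin, fun v w u hvw _ hv hw _ _ => hleave ⟨v, hv, w, hw, hvw⟩⟩
    have hcard : (s \ insert a P).ncard = n := by
      have h : s \ insert a P = (s \ P) \ {a} := by grind
      rw [h, Set.ncard_sdiff_singleton_of_mem ha, hn, Nat.add_sub_cancel]
    suffices h : ∃ τ : V → V → Prop, IsLinOrdOn s τ ∧
        (∀ u v, placeNext s P σ a u v → τ u v) ∧
        ∀ v w u x, E v w → F u x → τ x w → τ u v ∧ u ≠ v by
      obtain ⟨τ, hτ, hext, hτclosed⟩ := h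
      exact ⟨τ, hτ, fun u v h => hext u v (.inl h), hτclosed⟩
    refine ih (P := insert a P) (hσ.placeNext hlow hmin)
      (fun u x h => .inl (hFσ u x h)) ?_ (Set.insert_subset ha.1 hPs) ?_ ?_ hcard
    · rintro v w u x hvw hux (hxw | ⟨rfl, hw⟩)
      · exact ⟨.inl (hclosed v w u x hvw hux hxw).1, (hclosed v w u x hvw hux hxw).2⟩
      · obtain ⟨hu, -, hne⟩ := hF u x hux
        have huP : u ∈ P := by
          by_contra huP
          exact hne (hmin u ⟨hu, huP⟩ (hFσ u x hux))
        by_cases hv : v ∈ P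
        · have hvu := hgood v w u hvw hux hv hw.2 huP
          refine ⟨.inl ((htot u huP v hv).resolve_right hvu), ?_⟩
          rintro rfl
          exact hvu (hrefl u hu)
        · exact ⟨.inl (hlow u huP v ⟨(hE v w hvw).1, hv⟩), fun h => hv (h ▸ huP)⟩
    · rintro x (rfl | hx) y (rfl | hy)
      · exact .inl (.inr ⟨rfl, ha⟩)
      · exact .inr (.inl (hlow y hy x ha))
      · exact .inl (.inl (hlow x hx y ha))
      · exact (htot x hx y hy).imp .inl .inl
    · rintro p (rfl | hp) q hq
      · exact .inr ⟨rfl, hq.1, fun h => hq.2 (.inr h)⟩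
      · exact .inl (hlow p hp q ⟨hq.1, fun h => hq.2 (.inr h)⟩)

end

/-- There is a left-closed linear order extending the partial order
`α` induced by `ζ` iff there is a left-closed partial order extending `α`. -/
theorem leftClosed_linear_iff_partial {V : Type u} [Fintype V] {k : ℕ}
    (G : Fin k → GraphOn V) (S : GraphOn V) (hsun : IsSunflower G S)
    (ζ : ∀ i, StraightEnum (G i)) (hζ : IsSimEnum G S ζ)
    (hdist : ∀ i, ∀ u ∈ (G i).verts, ∀ v ∈ (G i).verts,
      (ζ i).le u v → (ζ i).le v u → u = v) :
    (∃ τ : V → V → Prop, IsLinOrdOn (⋃ i, (G i).verts) τ ∧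
        (∀ u v, alphaOrd G ζ u v → τ u v) ∧ LeftClosed G ζ τ) ↔
      (∃ σ : V → V → Prop, IsPartialOrderOn (⋃ i, (G i).verts) σ ∧
        (∀ u v, alphaOrd G ζ u v → σ u v) ∧ LeftClosed G ζ σ) := by
  constructor
  · rintro ⟨τ, hτ, hext, hclosed⟩
    exact ⟨τ, hτ.isPartialOrderOn, hext, hclosed⟩
  · rintro ⟨σ, hσ, hext, hclosed⟩
    obtain ⟨τ, hτ, hστ, hτclosed⟩ := exists_leftClosed_linear_extension_of_initial
      (P := ∅) (E := ERel G ζ) (F := FRel G ζ)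
      (fun v w h => by
        obtain ⟨-, i, hi⟩ := h
        exact (unionGraph G).mem_of_adj ⟨i, hi⟩)
      (fun u x h => by
        obtain ⟨-, hne, i, hu, hx, -⟩ := h
        exact ⟨Set.mem_iUnion.2 ⟨i, hu⟩, Set.mem_iUnion.2 ⟨i, hx⟩, hne⟩)
      hσ (fun u x h => hext u x h.1) hclosed (Set.empty_subset _) (by simp) (by simp)
    exact ⟨τ, hτ, fun u v h => hστ u v (hext u v h), hτclosed⟩
end

section
/- Let 𝒢 = (G_1,…,G_k) be a sunflower graph with simultaneous enumeration ζ, and let τ be a linear order on V(𝒢) extending the partial order α on V(𝒢) induced by ζ. Then τ is a fine enumeration of some graph H on vertex set V(𝒢) that contains G_1,…,G_k as induced subgraphs if and only if τ is left-closed. -/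
/-!
Common definitions: graphs on a vertex subset, (proper/unit) interval
representations, blocks, straight enumerations, sunflower graphs,
simultaneous enumerations, components, chains/bars, etc.
-/

universe u

open GraphOn

variable {V : Type u}

/-- The pair `a ≤ b` of vertices is covered, with respect to `τ`, by a pair of `E`. -/
def CoveredPair {k : ℕ} (G : Fin k → GraphOn V) (σ : ∀ i, StraightEnum (G i))
    (τ : V → V → Prop) (a b : V) : Prop :=
  a ∈ (⋃ i, (G i).verts) ∧ b ∈ (⋃ i, (G i).verts) ∧ τ a b ∧
    ∃ v w, ERel G σ v w ∧ τ v a ∧ τ b w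

theorem ERel.mem_verts {k : ℕ} {G : Fin k → GraphOn V} {σ : ∀ i, StraightEnum (G i)} {v w : V}
    (h : ERel G σ v w) : v ∈ (⋃ i, (G i).verts) ∧ w ∈ (⋃ i, (G i).verts) := by
  obtain ⟨_, i, hi⟩ := h
  exact (unionGraph G).mem_of_adj ⟨i, hi⟩

/-- Subintervals of covered pairs are covered. -/
theorem CoveredPair.mono {k : ℕ} {G : Fin k → GraphOn V} {σ : ∀ i, StraightEnum (G i)}
    {τ : V → V → Prop} (hτ : IsLinOrdOn (⋃ i, (G i).verts) τ) {a b a' b' : V}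
    (h : CoveredPair G σ τ a b) (ha' : a' ∈ (⋃ i, (G i).verts))
    (hb' : b' ∈ (⋃ i, (G i).verts)) (haa' : τ a a') (hab' : τ a' b') (hbb' : τ b' b) :
    CoveredPair G σ τ a' b' := by
  obtain ⟨ha, hb, _, v, w, hE, hva, hbw⟩ := h
  obtain ⟨hv, hw⟩ := hE.mem_verts
  exact ⟨ha', hb', hab', v, w, hE, hτ.2.1 v hv a ha a' ha' hva haa',
    hτ.2.1 b' hb' b hb w hw hbb' hbw⟩

/-- Covered pairs of distinct vertices, in either order, form a graph for which `τ` is a fine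
enumeration. -/
theorem fineEnumOn_coveredPair {k : ℕ} {G : Fin k → GraphOn V} {σ : ∀ i, StraightEnum (G i)}
    {τ : V → V → Prop} (hτ : IsLinOrdOn (⋃ i, (G i).verts) τ) :
    FineEnumOn (⋃ i, (G i).verts)
      (fun a b => a ≠ b ∧ (CoveredPair G σ τ a b ∨ CoveredPair G σ τ b a)) τ := by
  refine ⟨hτ, fun u hu a ha b hb c hc hab hbc hua huc => ?_⟩
  have ⟨hrefl, htrans, hanti, htotal⟩ := hτ
  by_cases hub : u = b
  · exact Or.inr hub
  refine Or.inl ⟨hub, ?_⟩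
  rcases htotal u hu b hb with h | h
  · rcases huc with ⟨huc, hP | hP⟩ | rfl
    · exact Or.inl (hP.mono hτ hu hb (hrefl u hu) h hbc)
    · exact absurd (hanti u hu c hc (htrans u hu b hb c hc h hbc) hP.2.2.1) huc
    · exact absurd (hanti u hu b hb h hbc) hub
  · rcases hua with ⟨hua, hP | hP⟩ | rfl
    · exact absurd (hanti u hu a ha hP.2.2.1 (htrans a ha b hb u hu hab h)) hua
    · exact Or.inr (hP.mono hτ hb hu hab h (hrefl u hu))
    · exact absurd (hanti u hu b hb hab h) hub

/-- If `τ` is left-closed and extends `α`, covered pairs within one `G i` are edges. -/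
theorem CoveredPair.adj {k : ℕ} {G : Fin k → GraphOn V} {σ : ∀ i, StraightEnum (G i)}
    {τ : V → V → Prop} (hτ : IsLinOrdOn (⋃ i, (G i).verts) τ)
    (hext : ∀ u v, alphaOrd G σ u v → τ u v) (hleft : LeftClosed G σ τ) {i : Fin k} {a b : V}
    (ha : a ∈ (G i).verts) (hb : b ∈ (G i).verts) (hne : a ≠ b)
    (h : CoveredPair G σ τ a b) : (G i).Adj a b := by
  by_contra hnadj
  obtain ⟨ha', hb', hab, v, w, hE, hva, hbw⟩ := h
  have hα : alphaOrd G σ a b := by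
    rcases (σ i).total a ha b hb with h | h
    · exact .single ⟨i, ha, hb, h⟩
    · exact absurd (hτ.2.2.1 a ha' b hb' hab (hext b a (.single ⟨i, hb, ha, h⟩))) hne
  obtain ⟨hav, hav'⟩ := hleft v w a b hE ⟨hα, hne, i, ha, hb, hnadj⟩ hbw
  exact hav' (hτ.2.2.1 a ha' v hE.mem_verts.1 hav hva)

/-- Edges of the `G i` that are ordered by `σ i` are covered pairs. -/
theorem CoveredPair.of_adj {k : ℕ} {G : Fin k → GraphOn V} {σ : ∀ i, StraightEnum (G i)}
    {τ : V → V → Prop} (hτ : IsLinOrdOn (⋃ i, (G i).verts) τ)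
    (hext : ∀ u v, alphaOrd G σ u v → τ u v) {i : Fin k} {a b : V}
    (hadj : (G i).Adj a b) (hle : (σ i).le a b) : CoveredPair G σ τ a b := by
  obtain ⟨ha, hb⟩ := (G i).mem_of_adj hadj
  have hα : alphaOrd G σ a b := .single ⟨i, ha, hb, hle⟩
  have ha' : a ∈ (⋃ i, (G i).verts) := Set.mem_iUnion.2 ⟨i, ha⟩
  have hb' : b ∈ (⋃ i, (G i).verts) := Set.mem_iUnion.2 ⟨i, hb⟩
  exact ⟨ha', hb', hext a b hα, a, b, ⟨hα, i, hadj⟩, hτ.1 a ha', hτ.1 b hb'⟩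

/-- A fine enumeration of a graph containing all `G i` as induced subgraphs is left-closed. -/
theorem FineEnumOn.leftClosed {k : ℕ} {G : Fin k → GraphOn V} {σ : ∀ i, StraightEnum (G i)}
    {A τ : V → V → Prop} (hfine : FineEnumOn (⋃ i, (G i).verts) A τ)
    (hext : ∀ u v, alphaOrd G σ u v → τ u v) (hsymm : ∀ u v, A u v → A v u)
    (hind : ∀ i, ∀ u ∈ (G i).verts, ∀ v ∈ (G i).verts, (A u v ↔ (G i).Adj u v)) :
    LeftClosed G σ τ := by
  obtain ⟨⟨hrefl, htrans, hanti, htotal⟩, hcons⟩ := hfine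
  rintro v w u x hE ⟨hαux, hux, j, huj, hxj, hnadj⟩ hxw
  obtain ⟨hv, hw⟩ := hE.mem_verts
  obtain ⟨_, i, hadj⟩ := hE
  have hu : u ∈ (⋃ i, (G i).verts) := Set.mem_iUnion.2 ⟨j, huj⟩
  have hx : x ∈ (⋃ i, (G i).verts) := Set.mem_iUnion.2 ⟨j, hxj⟩
  have hτux := hext u x hαux
  by_contra hcon
  have hvu : τ v u := by
    rcases htotal u hu v hv with h | h
    · by_cases he : u = v
      · exact he ▸ hrefl u hu
      · exact absurd ⟨h, he⟩ hcon
    · exact h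
  obtain ⟨hvi, hwi⟩ := (G i).mem_of_adj hadj
  have hvx : A v x ∨ v = x := hcons v hv v hv x hx w hw (htrans v hv u hu x hx hvu hτux) hxw
    (Or.inr rfl) (Or.inl ((hind i v hvi w hwi).2 hadj))
  rcases hcons x hx v hv u hu x hx hvu hτux (hvx.imp (hsymm v x) Eq.symm) (Or.inr rfl) with h | h
  · exact hnadj ((hind j u huj x hxj).1 (hsymm x u h))
  · exact hux h.symm

/-- A linear order `τ` on `V(𝒢)` extending the partial order `α`
induced by `ζ` is a fine enumeration of some graph `H` on `V(𝒢)` containing each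
`G_i` as an induced subgraph iff `τ` is left-closed. -/
theorem fineEnum_sandwich_iff_leftClosed {V : Type u} [Fintype V] {k : ℕ}
    (G : Fin k → GraphOn V) (S : GraphOn V) (hsun : IsSunflower G S)
    (ζ : ∀ i, StraightEnum (G i)) (hζ : IsSimEnum G S ζ)
    (hdist : ∀ i, ∀ u ∈ (G i).verts, ∀ v ∈ (G i).verts,
      (ζ i).le u v → (ζ i).le v u → u = v)
    (τ : V → V → Prop) (hτlin : IsLinOrdOn (⋃ i, (G i).verts) τ)
    (hτext : ∀ u v, alphaOrd G ζ u v → τ u v) :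
    (∃ A : V → V → Prop, (∀ u v, A u v → A v u) ∧ (∀ v, ¬ A v v) ∧
        (∀ u v, A u v → u ∈ (⋃ i, (G i).verts) ∧ v ∈ (⋃ i, (G i).verts)) ∧
        (∀ i, ∀ u ∈ (G i).verts, ∀ v ∈ (G i).verts, (A u v ↔ (G i).Adj u v)) ∧
        FineEnumOn (⋃ i, (G i).verts) A τ) ↔
      LeftClosed G ζ τ := by
  refine ⟨fun ⟨A, hsymm, _, _, hind, hfine⟩ => hfine.leftClosed hτext hsymm hind,
    fun hleft => ⟨fun a b => a ≠ b ∧ (CoveredPair G ζ τ a b ∨ CoveredPair G ζ τ b a),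
      fun u v h => ⟨h.1.symm, h.2.symm⟩, fun v h => h.1 rfl, ?_, ?_,
      fineEnumOn_coveredPair hτlin⟩⟩
  · rintro u v ⟨_, h | h⟩
    · exact ⟨h.1, h.2.1⟩
    · exact ⟨h.2.1, h.1⟩
  · refine fun i u hu v hv => ⟨?_, fun hadj => ⟨?_, ?_⟩⟩
    · rintro ⟨hne, h | h⟩
      · exact h.adj hτlin hτext hleft hu hv hne
      · exact (G i).symm (h.adj hτlin hτext hleft hv hu hne.symm)
    · rintro rfl
      exact (G i).loopless u hadj
    · exact ((ζ i).total u hu v hv).imp (CoveredPair.of_adj hτlin hτext hadj)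
        (CoveredPair.of_adj hτlin hτext ((G i).symm hadj))
end
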